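/- arXiv:2505.22743 — 8 statements merged into one kernel-verified Lean document; each statement's English description precedes it below -/
import Mathlib

section
/- Fourier coefficients of the m-copy likelihood ratio under single-qubit product measurements depend only on the corresponding reduced density matrix: let ρ be an n-qubit density matrix, m ≥ 1, and for each (i,r) ∈ [m]×[n] let {φ^{i,r}_0, φ^{i,r}_1} be an orthonormal basis of ℂ². Define, for s ∈ {0,1}^{[m]×[n]}, D̄(s) = 2^{mn} · ∏_{i=1}^m ⟨⊗_{r=1}^n φ^{i,r}_{s_{i,r}}, ρ (⊗_{r=1}^n φ^{i,r}_{s_{i,r}})⟩. Then for every T ⊆ [m]×[n]: 2^{−mn} Σ_{s ∈ {0,1}^{[m]×[n]}} D̄(s)·χ_T(s) = Σ_{u ∈ {0,1}^T} (−1)^{Σ_{(i,r)∈T} u_{i,r}} · tr( tr_{([m]×[n])∖T}(ρ^{⊗m}) · ⊗_{(i,r)∈T} φ^{i,r}_{u_{i,r}} (φ^{i,r}_{u_{i,r}})^* ). -/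
open Matrix BigOperators Finset
open scoped ComplexOrder

/-- The quadratic form `⟨u, M u⟩` of a matrix `M` at a vector `u`. -/
noncomputable def quadForm {ι : Type*} [Fintype ι] (M : Matrix ι ι ℂ) (u : ι → ℂ) : ℂ :=
  star u ⬝ᵥ (M *ᵥ u)

/-- `φ` is an orthonormal basis of `ℂ^ι`. -/
def IsONB {ι : Type*} [Fintype ι] [DecidableEq ι] (φ : ι → ι → ℂ) : Prop :=
  ∀ s t, star (φ s) ⬝ᵥ φ t = if s = t then 1 else 0

/-- Partial trace over the tensor factors outside `T`, for a matrix acting on the tensor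
product of `q`-dimensional factors indexed by `ι`. -/
noncomputable def ptrace {ι : Type*} [Fintype ι] [DecidableEq ι] {q : ℕ} (T : Finset ι)
    (M : Matrix (ι → Fin q) (ι → Fin q) ℂ) :
    Matrix ({i // i ∈ T} → Fin q) ({i // i ∈ T} → Fin q) ℂ :=
  Matrix.of fun a a' => ∑ b : {i // i ∉ T} → Fin q,
    M (fun i => if h : i ∈ T then a ⟨i, h⟩ else b ⟨i, h⟩)
      (fun i => if h : i ∈ T then a' ⟨i, h⟩ else b ⟨i, h⟩)

/-- The `m`-fold tensor power `ρ^{⊗m}` of an `n`-qubit state, acting on the `m·n` qubits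
indexed by `Fin m × Fin n`. -/
noncomputable def copyPow {n : ℕ} (m : ℕ)
    (ρ : Matrix (Fin n → Fin 2) (Fin n → Fin 2) ℂ) :
    Matrix (Fin m × Fin n → Fin 2) (Fin m × Fin n → Fin 2) ℂ :=
  Matrix.of fun f g => ∏ i : Fin m, ρ (fun r => f (i, r)) (fun r => g (i, r))

/-- A sum over configurations on `ι` is an iterated sum over configurations on `T` and off `T`. -/
lemma sum_pi_eq_sum_sum_dite {ι : Type*} [Fintype ι] [DecidableEq ι] {q : ℕ} (T : Finset ι)
    (F : (ι → Fin q) → ℂ) :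
    ∑ s, F s = ∑ a : {i // i ∈ T} → Fin q, ∑ b : {i // i ∉ T} → Fin q,
      F (fun i => if h : i ∈ T then a ⟨i, h⟩ else b ⟨i, h⟩) := by
  rw [← Fintype.sum_prod_type',
    ← (Equiv.piEquivPiSubtypeProd (fun i => i ∈ T) (fun _ => Fin q)).symm.sum_comp]
  rfl

/-- The completeness relation of an orthonormal basis. -/
lemma IsONB.sum_conj_mul {ι : Type*} [Fintype ι] [DecidableEq ι] {φ : ι → ι → ℂ}
    (hφ : IsONB φ) (x y : ι) :
    ∑ t, (starRingEnd ℂ) (φ t x) * φ t y = if x = y then 1 else 0 := by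
  have h : (Matrix.of fun s a => (starRingEnd ℂ) (φ s a)) * (Matrix.of φ)ᵀ = 1 := by
    ext s t
    simpa [Matrix.mul_apply, Matrix.one_apply, dotProduct] using hφ s t
  have h' := congrArg (fun N : Matrix ι ι ℂ => N y x) (mul_eq_one_comm.mp h)
  simpa [Matrix.mul_apply, Matrix.one_apply, mul_comm, eq_comm] using h'

/-- Summing the product kernel over all configurations gives the identity kernel. -/
lemma sum_prod_conj_mul {κ ι : Type*} [Fintype κ] [DecidableEq κ] [Fintype ι] [DecidableEq ι]
    {φ : κ → ι → ι → ℂ} (hφ : ∀ p, IsONB (φ p)) (b b' : κ → ι) :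
    ∑ v : κ → ι, ∏ p, ((starRingEnd ℂ) (φ p (v p) (b p)) * φ p (v p) (b' p))
      = if b = b' then 1 else 0 := by
  rw [← Fintype.prod_sum (fun p t => (starRingEnd ℂ) (φ p t (b p)) * φ p t (b' p))]
  simp_rw [fun p => (hφ p).sum_conj_mul, Fintype.prod_ite_zero, funext_iff, Finset.prod_const_one]

/-- The product of single-copy outcome weights as a quadratic form of the tensor power. -/
lemma prod_quadForm_eq_sum_copyPow {n : ℕ} (m : ℕ)
    (ρ : Matrix (Fin n → Fin 2) (Fin n → Fin 2) ℂ) (ψ : Fin m × Fin n → Fin 2 → ℂ) :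
    ∏ i : Fin m, quadForm ρ (fun a => ∏ r : Fin n, ψ (i, r) (a r))
      = ∑ f, ∑ g, copyPow m ρ f g * ∏ p, ((starRingEnd ℂ) (ψ p (f p)) * ψ p (g p)) := by
  have hq : ∀ i, quadForm ρ (fun a => ∏ r : Fin n, ψ (i, r) (a r)) = ∑ a, ∑ b,
      ρ a b * ∏ r, ((starRingEnd ℂ) (ψ (i, r) (a r)) * ψ (i, r) (b r)) := by
    intro i
    simp only [quadForm, dotProduct, mulVec, Finset.mul_sum, Finset.prod_mul_distrib,
      Pi.star_apply, ← starRingEnd_apply, map_prod]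
    exact Finset.sum_congr rfl fun a _ => Finset.sum_congr rfl fun b _ => by ring
  simp_rw [hq, Fintype.prod_sum]
  rw [← (Equiv.curry (Fin m) (Fin n) (Fin 2)).sum_comp]
  refine Finset.sum_congr rfl fun f _ => ?_
  rw [← (Equiv.curry (Fin m) (Fin n) (Fin 2)).sum_comp]
  refine Finset.sum_congr rfl fun g _ => ?_
  rw [Finset.prod_mul_distrib, Fintype.prod_prod_type]
  rfl

/-- Fourier coefficients of the outcome weights of a product measurement are determined by the
partial trace onto the support of the character. -/
lemma sum_weight_mul_character {ι : Type*} [Fintype ι] [DecidableEq ι] {q : ℕ} (T : Finset ι)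
    (M : Matrix (ι → Fin q) (ι → Fin q) ℂ) {φ : ι → Fin q → Fin q → ℂ}
    (hφ : ∀ p, IsONB (φ p)) :
    ∑ s : ι → Fin q, (∑ f, ∑ g, M f g *
        ∏ p, ((starRingEnd ℂ) (φ p (s p) (f p)) * φ p (s p) (g p))) *
          (-1 : ℂ) ^ (∑ p ∈ T, (s p).val)
      = ∑ u : {p // p ∈ T} → Fin q, (-1 : ℂ) ^ (∑ p : {p // p ∈ T}, (u p).val) *
          (ptrace T M * Matrix.of (fun a a' : {p // p ∈ T} → Fin q =>
            ∏ p : {p // p ∈ T},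
              φ p.val (u p) (a p) * (starRingEnd ℂ) (φ p.val (u p) (a' p)))).trace := by
  rw [sum_pi_eq_sum_sum_dite T]
  refine Finset.sum_congr rfl fun u _ => ?_
  have hchar : ∀ v : {i // i ∉ T} → Fin q,
      ∑ p ∈ T, (if h : p ∈ T then u ⟨p, h⟩ else v ⟨p, h⟩).val = ∑ p : {p // p ∈ T}, (u p).val := by
    intro v
    rw [← Finset.sum_coe_sort]
    exact Finset.sum_congr rfl fun p _ => by simp [p.2]
  simp_rw [hchar]
  rw [← Finset.sum_mul, mul_comm]
  congr 1
  rw [Finset.sum_comm]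
  simp_rw [Finset.sum_comm (s := (Finset.univ : Finset ({i // i ∉ T} → Fin q)))
    (t := (Finset.univ : Finset (ι → Fin q))), ← Finset.mul_sum]
  have hker : ∀ (a a' : {i // i ∈ T} → Fin q) (b b' : {i // i ∉ T} → Fin q),
      ∑ v : {i // i ∉ T} → Fin q, ∏ p,
        ((starRingEnd ℂ) (φ p (if h : p ∈ T then u ⟨p, h⟩ else v ⟨p, h⟩)
            (if h : p ∈ T then a ⟨p, h⟩ else b ⟨p, h⟩)) *
          φ p (if h : p ∈ T then u ⟨p, h⟩ else v ⟨p, h⟩)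
            (if h : p ∈ T then a' ⟨p, h⟩ else b' ⟨p, h⟩))
        = (∏ p : {p // p ∈ T}, (φ p.val (u p) (a' p) * (starRingEnd ℂ) (φ p.val (u p) (a p)))) *
          if b = b' then 1 else 0 := by
    intro a a' b b'
    rw [← sum_prod_conj_mul (φ := fun p : {i // i ∉ T} => φ p) (fun p => hφ p) b b',
      Finset.mul_sum]
    refine Finset.sum_congr rfl fun v _ => ?_
    rw [← Fintype.prod_subtype_mul_prod_subtype (fun p => p ∈ T)]
    refine congrArg₂ (· * ·) (Finset.prod_congr ?_ fun p _ => ?_)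
      (Finset.prod_congr ?_ fun p _ => ?_)
    · ext; simp
    · simp [p.2, mul_comm]
    · ext; simp
    · simp [p.2]
  simp only [Matrix.trace, Matrix.diag_apply, Matrix.mul_apply, Matrix.of_apply, ptrace]
  rw [sum_pi_eq_sum_sum_dite T]
  refine Finset.sum_congr rfl fun a _ => ?_
  simp_rw [sum_pi_eq_sum_sum_dite T (fun g => _ * _), hker]
  rw [Finset.sum_comm]
  refine Finset.sum_congr rfl fun a' _ => ?_
  rw [Finset.sum_mul]
  refine Finset.sum_congr rfl fun b _ => ?_
  simp

/-- Fourier coefficients of the `m`-copy likelihood ratio under single-qubit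
product measurements depend only on the corresponding reduced density matrix. -/
theorem fourier_coeff_eq_reduced_density
    (n m : ℕ) (hm : 1 ≤ m)
    (ρ : Matrix (Fin n → Fin 2) (Fin n → Fin 2) ℂ)
    (hρ : ρ.PosSemidef) (htrρ : ρ.trace = 1)
    (φ : Fin m × Fin n → Fin 2 → Fin 2 → ℂ) (hφ : ∀ p, IsONB (φ p))
    (T : Finset (Fin m × Fin n)) :
    ((2 : ℂ) ^ (m * n))⁻¹ *
      ∑ s : Fin m × Fin n → Fin 2,
        ((2 : ℂ) ^ (m * n) *
            ∏ i : Fin m, quadForm ρ (fun a => ∏ r : Fin n, φ (i, r) (s (i, r)) (a r))) *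
          (-1 : ℂ) ^ (∑ p ∈ T, (s p).val)
      = ∑ u : {p // p ∈ T} → Fin 2,
          (-1 : ℂ) ^ (∑ p : {p // p ∈ T}, (u p).val) *
            (ptrace T (copyPow m ρ) *
              Matrix.of (fun a a' : {p // p ∈ T} → Fin 2 =>
                ∏ p : {p // p ∈ T},
                  φ p.val (u p) (a p) * (starRingEnd ℂ) (φ p.val (u p) (a' p)))).trace := by
  have h2 : ((2 : ℂ) ^ (m * n)) ≠ 0 := by positivity
  simp_rw [mul_assoc, ← Finset.mul_sum, inv_mul_cancel_left₀ h2]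
  rw [← sum_weight_mul_character T (copyPow m ρ) hφ]
  exact Finset.sum_congr rfl fun s _ => by
    rw [prod_quadForm_eq_sum_copyPow m ρ (fun p => φ p (s p))]
end

section
/- Approximate state 2-designs have rotated marginals close to maximally mixed in expected squared Frobenius norm: let n ≥ 1, d = 2^n, ε ∈ [0,1], and let ν be a Löwner ε-approximate state 2-design on ℂ^d. Then for every unitary U on ℂ^d and every subset A ⊆ [n] of the qubits, E_{ψ∼ν} ‖ tr_{[n]∖A}(U ψψ^* U^†) − 2^{−|A|}·I ‖₂² ≤ 2·2^{|A|−n} + 4ε. -/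
open Matrix BigOperators Finset
open scoped ComplexOrder

/-- The rank-one projector `ψψ^*` onto the vector `ψ`. -/
noncomputable def projVec {ι : Type*} (ψ : ι → ℂ) : Matrix ι ι ℂ :=
  Matrix.vecMulVec ψ (star ψ)

/-- The tensor square `M ⊗ M` of a matrix, on the doubled index. -/
noncomputable def tsq {ι : Type*} (M : Matrix ι ι ℂ) : Matrix (ι × ι) (ι × ι) ℂ :=
  Matrix.of fun p q => M p.1 q.1 * M p.2 q.2

/-- The swap operator `S(u ⊗ v) = v ⊗ u` on `ℂ^ι ⊗ ℂ^ι`. -/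
noncomputable def swapMat (ι : Type*) [DecidableEq ι] : Matrix (ι × ι) (ι × ι) ℂ :=
  Matrix.of fun p q => if p.1 = q.2 ∧ p.2 = q.1 then 1 else 0

/-- The squared Frobenius norm of a matrix. -/
noncomputable def frobSq {ι : Type*} [Fintype ι] (M : Matrix ι ι ℂ) : ℝ :=
  ∑ a, ∑ b, ‖M a b‖ ^ 2

/-- The configuration agreeing with `a` on `T` and with `b` off `T`. -/
def glue {ι : Type*} [DecidableEq ι] {q : ℕ} (T : Finset ι)
    (a : {i // i ∈ T} → Fin q) (b : {i // i ∉ T} → Fin q) : ι → Fin q :=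
  fun i => if h : i ∈ T then a ⟨i, h⟩ else b ⟨i, h⟩

/-- The permutation of pairs of configurations which exchanges their `T`-coordinates. -/
def partialSwap {ι : Type*} [DecidableEq ι] {q : ℕ} (T : Finset ι)
    (p : (ι → Fin q) × (ι → Fin q)) : (ι → Fin q) × (ι → Fin q) :=
  (fun i => if i ∈ T then p.2 i else p.1 i, fun i => if i ∈ T then p.1 i else p.2 i)

section Glue

variable {ι : Type*} [DecidableEq ι] {q : ℕ} (T : Finset ι)

theorem partialSwap_involutive : Function.Involutive (partialSwap (q := q) T) := by
  intro p
  ext i <;> simp only [partialSwap] <;> split_ifs <;> rfl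

theorem partialSwap_glue (a a' : {i // i ∈ T} → Fin q) (b b' : {i // i ∉ T} → Fin q) :
    partialSwap T (glue T a b, glue T a' b') = (glue T a' b, glue T a b') := by
  ext i <;> simp only [partialSwap, glue] <;> split_ifs <;> rfl

theorem glue_inj {a a' : {i // i ∈ T} → Fin q} {b b' : {i // i ∉ T} → Fin q} :
    glue T a b = glue T a' b' ↔ a = a' ∧ b = b' := by
  have h := (Equiv.piEquivPiSubtypeProd (· ∈ T) (fun _ : ι => Fin q)).symm.injective.eq_iff
    (a := (a, b)) (b := (a', b'))
  rw [Prod.mk.injEq] at h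
  exact h

variable [Fintype ι]

theorem sum_glue {R : Type*} [AddCommMonoid R] (f : (ι → Fin q) → R) :
    ∑ x, f x = ∑ a, ∑ b, f (glue T a b) := by
  rw [← Fintype.sum_prod_type']
  exact ((Equiv.piEquivPiSubtypeProd (· ∈ T) (fun _ : ι => Fin q)).symm.sum_comp f).symm

theorem ptrace_apply (M : Matrix (ι → Fin q) (ι → Fin q) ℂ) (a a' : {i // i ∈ T} → Fin q) :
    ptrace T M a a' = ∑ b, M (glue T a b) (glue T a' b) := rfl

theorem trace_ptrace (M : Matrix (ι → Fin q) (ι → Fin q) ℂ) :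
    (ptrace T M).trace = M.trace := by
  simp only [Matrix.trace, Matrix.diag, ptrace_apply]
  exact (sum_glue T fun x => M x x).symm

theorem isHermitian_ptrace {M : Matrix (ι → Fin q) (ι → Fin q) ℂ} (hM : M.IsHermitian) :
    (ptrace T M).IsHermitian := by
  ext a a'
  simp only [conjTranspose_apply, ptrace_apply, star_sum, hM.apply]

theorem sum_pair_glue {R : Type*} [AddCommMonoid R] (f : (ι → Fin q) × (ι → Fin q) → R) :
    ∑ p, f p = ∑ a, ∑ b, ∑ a', ∑ b', f (glue T a b, glue T a' b') := by
  rw [Fintype.sum_prod_type, sum_glue T]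
  simp only [sum_glue T fun y => f (_, y)]

theorem sum_tsq_partialSwap (M : Matrix (ι → Fin q) (ι → Fin q) ℂ) :
    ∑ p, tsq M p (partialSwap T p) = ∑ a, ∑ a', ptrace T M a a' * ptrace T M a' a := by
  rw [sum_pair_glue T]
  simp only [partialSwap_glue, tsq, Matrix.of_apply, ptrace_apply, Finset.sum_mul_sum]
  exact Finset.sum_congr rfl fun a _ => Finset.sum_comm

theorem sum_one_partialSwap :
    ∑ p, (1 : Matrix ((ι → Fin q) × (ι → Fin q)) _ ℂ) p (partialSwap T p)
      = (q : ℂ) ^ T.card * ((q : ℂ) ^ Tᶜ.card) ^ 2 := by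
  rw [sum_pair_glue T]
  have h : Fintype.card {i // i ∉ T} = Tᶜ.card := by
    rw [Fintype.card_subtype_compl, Fintype.card_coe, Finset.card_compl]
  simp [partialSwap_glue, Matrix.one_apply, glue_inj, ite_and, h, Finset.card_compl]
  left
  ring

theorem sum_swapMat_partialSwap :
    ∑ p, swapMat (ι → Fin q) p (partialSwap T p)
      = ((q : ℂ) ^ T.card) ^ 2 * (q : ℂ) ^ Tᶜ.card := by
  rw [sum_pair_glue T]
  simp [partialSwap_glue, swapMat, glue_inj, ite_and, Finset.card_compl]
  ring

end Glue

theorem sum_tsq_diag {X : Type*} [Fintype X] (M : Matrix X X ℂ) :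
    ∑ p, tsq M p p = M.trace ^ 2 := by
  simp [Fintype.sum_prod_type, tsq, Matrix.trace, sq, Finset.sum_mul_sum]

theorem sum_swapMat_diag (X : Type*) [Fintype X] [DecidableEq X] :
    ∑ p, swapMat X p p = Fintype.card X := by
  simp [Fintype.sum_prod_type, swapMat, ite_and, eq_comm]

theorem frobSq_eq_of_isHermitian {X : Type*} [Fintype X] {M : Matrix X X ℂ}
    (hM : M.IsHermitian) : (frobSq M : ℂ) = ∑ a, ∑ b, M a b * M b a := by
  simp only [frobSq, Complex.ofReal_sum]
  refine Finset.sum_congr rfl fun a _ => Finset.sum_congr rfl fun b _ => ?_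
  rw [← hM.apply b a, Complex.star_def, Complex.mul_conj, Complex.normSq_eq_norm_sq]

theorem frobSq_sub_smul_one {X : Type*} [Fintype X] [DecidableEq X] {M : Matrix X X ℂ}
    (hM : M.IsHermitian) (htr : M.trace = 1) {c : ℝ} (hc : c * Fintype.card X = 1) :
    frobSq (M - (c : ℂ) • (1 : Matrix X X ℂ)) = frobSq M - c := by
  have hN : (M - (c : ℂ) • (1 : Matrix X X ℂ)).IsHermitian := by
    refine hM.sub ?_
    simp [Matrix.IsHermitian, conjTranspose_smul]
  have key : ∀ N : Matrix X X ℂ, ∑ a, ∑ b, N a b * N b a = (N * N).trace := fun N => by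
    simp [Matrix.trace, Matrix.mul_apply]
  have hc' : (c : ℂ) * Fintype.card X = 1 := by exact_mod_cast hc
  apply Complex.ofReal_injective
  rw [Complex.ofReal_sub, frobSq_eq_of_isHermitian hN, frobSq_eq_of_isHermitian hM, key, key]
  simp only [sub_mul, mul_sub, Matrix.trace_sub, mul_smul_comm, smul_mul_assoc, one_mul, mul_one,
    Matrix.trace_smul, htr, Matrix.trace_one, smul_eq_mul]
  linear_combination (c : ℂ) * hc'

/-- Pairing a positive semidefinite matrix with `1 + s W`, where `W` is the permutation matrix of
an involution and `s` is a sign, gives a nonnegative number. -/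
theorem Matrix.PosSemidef.sum_diag_add_sum_involutive_nonneg {X : Type*} [Fintype X]
    [DecidableEq X] {M : Matrix X X ℂ} (hM : M.PosSemidef) {σ : X → X}
    (hσ : Function.Involutive σ) {s : ℝ} (hs : s ^ 2 = 1) :
    0 ≤ ∑ p, M p p + (s : ℂ) * ∑ p, M p (σ p) := by
  have hs' : (s : ℂ) * s = 1 := by rw [← sq]; exact_mod_cast hs
  have h : ∀ p, 0 ≤ M p p + (s : ℂ) * M p (σ p) + s * M (σ p) p + M (σ p) (σ p) := fun p => by
    have := hM.dotProduct_mulVec_nonneg (Pi.single p 1 + (s : ℂ) • Pi.single (σ p) 1)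
    simp only [star_add, star_smul, Pi.star_single, star_one, Matrix.mulVec_add,
      Matrix.mulVec_smul, Matrix.mulVec_single_one, add_dotProduct, smul_dotProduct,
      dotProduct_add, dotProduct_smul, single_one_dotProduct, Matrix.col_apply, smul_eq_mul,
      Complex.star_def, Complex.conj_ofReal] at this
    convert this using 1
    linear_combination -M (σ p) (σ p) * hs'
  have hsum := Finset.sum_nonneg fun p (_ : p ∈ Finset.univ) => h p
  have h₁ : ∑ p, M (σ p) (σ p) = ∑ p, M p p := Equiv.sum_comp hσ.toPerm fun p => M p p
  have h₂ : ∑ p, M (σ p) p = ∑ p, M p (σ p) := by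
    rw [← Equiv.sum_comp hσ.toPerm fun p => M p (σ p)]
    simp [hσ _]
  simp only [Finset.sum_add_distrib, ← Finset.mul_sum, h₁, h₂] at hsum
  have := mul_nonneg (show (0 : ℂ) ≤ ((1 / 2 : ℝ) : ℂ) by
    exact_mod_cast (by norm_num : (0 : ℝ) ≤ 1 / 2)) hsum
  convert this using 1
  push_cast
  ring

theorem tsq_eq_kronecker {X : Type*} (M : Matrix X X ℂ) :
    tsq M = Matrix.kroneckerMap (· * ·) M M := rfl

theorem tsq_mul {X : Type*} [Fintype X] (M N : Matrix X X ℂ) :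
    tsq (M * N) = tsq M * tsq N := by
  simp only [tsq_eq_kronecker, Matrix.mul_kronecker_mul]

theorem tsq_conjTranspose {X : Type*} (M : Matrix X X ℂ) : tsq Mᴴ = (tsq M)ᴴ := by
  ext p q
  simp [tsq]

theorem swapMat_mul_tsq {X : Type*} [Fintype X] [DecidableEq X] (M : Matrix X X ℂ) :
    swapMat X * tsq M = tsq M * swapMat X := by
  ext p q
  simp [Matrix.mul_apply, Fintype.sum_prod_type, swapMat, tsq, ite_and, mul_comm]

theorem tsq_mul_conjTranspose_of_mem_unitaryGroup {X : Type*} [Fintype X] [DecidableEq X]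
    {U : Matrix X X ℂ} (hU : U ∈ Matrix.unitaryGroup X ℂ) : tsq U * (tsq U)ᴴ = 1 := by
  have h : U * Uᴴ = 1 := Matrix.mem_unitaryGroup_iff.mp hU
  rw [← tsq_conjTranspose, ← tsq_mul, h]
  simp [tsq_eq_kronecker]

theorem posSemidef_design_conj {X J : Type*} [Fintype X] [DecidableEq X] [Fintype J]
    {U : Matrix X X ℂ} (hU : U ∈ Matrix.unitaryGroup X ℂ) {c r : ℂ} {w : J → ℂ}
    {P : J → Matrix X X ℂ}
    (h : (c • ((1 : Matrix (X × X) (X × X) ℂ) + swapMat X)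
      - r • ∑ j, w j • tsq (P j)).PosSemidef) :
    (c • ((1 : Matrix (X × X) (X × X) ℂ) + swapMat X)
      - r • ∑ j, w j • tsq (U * P j * Uᴴ)).PosSemidef := by
  have hswap : tsq U * (1 + swapMat X) * (tsq U)ᴴ = 1 + swapMat X := by
    rw [mul_add, mul_one, ← swapMat_mul_tsq, add_mul, mul_assoc,
      tsq_mul_conjTranspose_of_mem_unitaryGroup hU, mul_one]
  have hconj := h.mul_mul_conjTranspose_same (tsq U)
  simpa only [Matrix.mul_sub, Matrix.sub_mul, Matrix.mul_smul, Matrix.smul_mul, hswap,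
    Matrix.mul_sum, Matrix.sum_mul, tsq_conjTranspose, tsq_mul] using hconj

theorem projVec_mulVec {X : Type*} [Fintype X] (U : Matrix X X ℂ) (φ : X → ℂ) :
    projVec (U *ᵥ φ) = U * projVec φ * Uᴴ := by
  rw [projVec, projVec, Matrix.mul_vecMulVec, Matrix.vecMulVec_mul, Matrix.star_mulVec]

theorem isHermitian_projVec {X : Type*} (φ : X → ℂ) : (projVec φ).IsHermitian := by
  ext a b
  simp [projVec, Matrix.vecMulVec_apply, mul_comm]

theorem trace_projVec {X : Type*} [Fintype X] (φ : X → ℂ) :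
    (projVec φ).trace = star φ ⬝ᵥ φ := by
  rw [projVec, Matrix.trace_vecMulVec, dotProduct_comm]

theorem posSemidef_tsq_projVec {X : Type*} [Fintype X] (φ : X → ℂ) :
    (tsq (projVec φ)).PosSemidef := by
  have h : tsq (projVec φ) = Matrix.vecMulVec (fun p : X × X => φ p.1 * φ p.2)
      (star fun p : X × X => φ p.1 * φ p.2) := by
    ext p q
    simp [tsq, projVec, Matrix.vecMulVec_apply]
    ring
  rw [h]
  exact Matrix.posSemidef_vecMulVec_self_star _

section Marginal

variable {ι : Type*} [Fintype ι] [DecidableEq ι] {q : ℕ} (T : Finset ι)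

theorem sum_tsq_partialSwap_of_isHermitian {M : Matrix (ι → Fin q) (ι → Fin q) ℂ}
    (hM : M.IsHermitian) :
    ∑ p, tsq M p (partialSwap T p) = (frobSq (ptrace T M) : ℂ) := by
  rw [sum_tsq_partialSwap, frobSq_eq_of_isHermitian (isHermitian_ptrace T hM)]

theorem frobSq_ptrace_projVec_le_one {φ : (ι → Fin q) → ℂ} (hφ : (projVec φ).trace = 1) :
    frobSq (ptrace T (projVec φ)) ≤ 1 := by
  have h := (posSemidef_tsq_projVec φ).sum_diag_add_sum_involutive_nonneg
    (partialSwap_involutive T) (s := -1) (by norm_num)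
  rw [sum_tsq_diag, hφ, sum_tsq_partialSwap_of_isHermitian T (isHermitian_projVec φ)] at h
  have h' : (0 : ℝ) ≤ 1 ^ 2 + -1 * frobSq (ptrace T (projVec φ)) := by exact_mod_cast h
  linarith

end Marginal

theorem purity_excess_le {a b P ε : ℝ} (ha : 1 ≤ a) (hb : 1 ≤ b) (hε0 : 0 ≤ ε) (hP : P ≤ 1)
    (h : (1 - ε) * (1 + P) ≤ 1 + (a + b) / (a * b + 1)) :
    P - a⁻¹ ≤ 2 * a / (a * b) + 4 * ε := by
  have ha0 : 0 < a := by linarith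
  have hb0 : 0 < b := by linarith
  have hab : 0 < a * b := mul_pos ha0 hb0
  have hfrac : 0 ≤ 2 * a / (a * b) := by positivity
  have hP0 : (a + b) / (a * b + 1) ≤ b⁻¹ + a⁻¹ := by
    rw [div_le_iff₀ (by linarith)]
    have : (b⁻¹ + a⁻¹) * (a * b + 1) = a + b + (b⁻¹ + a⁻¹) := by field_simp
    rw [this]
    have := inv_pos.mpr ha0
    have := inv_pos.mpr hb0
    linarith
  have hb' : 2 * a / (a * b) = 2 * b⁻¹ := by field_simp
  have := inv_pos.mpr hb0
  have : ε * P ≤ ε := mul_le_of_le_one_right hε0 hP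
  linarith

theorem marginal_purity_le (n : ℕ) {ε : ℝ}
    {J : Type*} [Fintype J] {w : J → ℝ} (hw1 : ∑ j, w j = 1)
    {φ : J → (Fin n → Fin 2) → ℂ} (hφ : ∀ j, (projVec (φ j)).trace = 1)
    (hdes : (((2 : ℂ) ^ n * ((2 : ℂ) ^ n + 1))⁻¹ •
        ((1 : Matrix ((Fin n → Fin 2) × (Fin n → Fin 2))
            ((Fin n → Fin 2) × (Fin n → Fin 2)) ℂ) + swapMat (Fin n → Fin 2))
      - ((1 - ε : ℝ) : ℂ) • ∑ j, (w j : ℂ) • tsq (projVec (φ j))).PosSemidef)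
    (A : Finset (Fin n)) :
    (1 - ε) * (1 + ∑ j, w j * frobSq (ptrace A (projVec (φ j))))
      ≤ 1 + ((2 : ℝ) ^ A.card + 2 ^ Aᶜ.card) / (2 ^ A.card * 2 ^ Aᶜ.card + 1) := by
  have h := hdes.sum_diag_add_sum_involutive_nonneg (partialSwap_involutive A) (s := 1)
    (by norm_num)
  have hn : (2 : ℂ) ^ n = 2 ^ A.card * 2 ^ Aᶜ.card := by
    rw [← pow_add, Finset.card_add_card_compl, Fintype.card_fin]
  have hone : ∑ p, (1 : Matrix ((Fin n → Fin 2) × (Fin n → Fin 2)) _ ℂ) p p = (2 ^ n) ^ 2 := by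
    simp [sq]
  have hsum : ∀ τ : (Fin n → Fin 2) × (Fin n → Fin 2) → (Fin n → Fin 2) × (Fin n → Fin 2),
      ∑ p, (∑ j, (w j : ℂ) • tsq (projVec (φ j))) p (τ p)
        = ∑ j, (w j : ℂ) * ∑ p, tsq (projVec (φ j)) p (τ p) := fun τ => by
    simp only [Matrix.sum_apply, Matrix.smul_apply, smul_eq_mul, Finset.mul_sum]
    exact Finset.sum_comm
  simp only [Matrix.sub_apply, Matrix.smul_apply, Matrix.add_apply, smul_eq_mul,
    Finset.sum_sub_distrib, ← Finset.mul_sum, Finset.sum_add_distrib] at h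
  rw [hsum (partialSwap A), hsum fun p => p] at h
  simp only [sum_tsq_diag, hφ, hone, sum_swapMat_diag, sum_one_partialSwap,
    sum_swapMat_partialSwap, sum_tsq_partialSwap_of_isHermitian A (isHermitian_projVec _),
    one_pow, mul_one, Fintype.card_fun, Fintype.card_fin, Nat.cast_pow, Nat.cast_ofNat, hn] at h
  have h' : (0 : ℝ) ≤ (2 ^ A.card * 2 ^ Aᶜ.card * (2 ^ A.card * 2 ^ Aᶜ.card + 1))⁻¹ *
      ((2 ^ A.card * 2 ^ Aᶜ.card) ^ 2 + 2 ^ A.card * 2 ^ Aᶜ.card) - (1 - ε) * ∑ j, w j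
      + 1 * ((2 ^ A.card * 2 ^ Aᶜ.card * (2 ^ A.card * 2 ^ Aᶜ.card + 1))⁻¹ *
      (2 ^ A.card * (2 ^ Aᶜ.card) ^ 2 + (2 ^ A.card) ^ 2 * 2 ^ Aᶜ.card)
      - (1 - ε) * ∑ j, w j * frobSq (ptrace A (projVec (φ j)))) := by
    rw [← Complex.zero_le_real]
    push_cast at h ⊢
    exact h
  have ha : (0 : ℝ) < 2 ^ A.card := by positivity
  have hb : (0 : ℝ) < 2 ^ Aᶜ.card := by positivity
  rw [hw1] at h'
  generalize (2 : ℝ) ^ A.card = a at *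
  generalize (2 : ℝ) ^ Aᶜ.card = b at *
  have e₁ : (a * b * (a * b + 1))⁻¹ * ((a * b) ^ 2 + a * b) = 1 := by
    have : a * b + 1 ≠ 0 := by positivity
    field_simp
  have e₂ : (a * b * (a * b + 1))⁻¹ * (a * b ^ 2 + a ^ 2 * b) = (a + b) / (a * b + 1) := by
    have : a * b + 1 ≠ 0 := by positivity
    field_simp
    ring
  rw [e₁, e₂] at h'
  linarith

/-- approximate state 2-designs have rotated marginals close to maximally
mixed in expected squared Frobenius norm. -/
theorem approx_two_design_marginal_frobenius
    (n : ℕ) (hn : 1 ≤ n) (ε : ℝ) (hε0 : 0 ≤ ε) (hε1 : ε ≤ 1)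
    (J : Type) [Fintype J] (w : J → ℝ) (hw0 : ∀ j, 0 ≤ w j) (hw1 : ∑ j, w j = 1)
    (ψ : J → (Fin n → Fin 2) → ℂ) (hψ : ∀ j, star (ψ j) ⬝ᵥ ψ j = 1)
    (hdes₁ : (((2 : ℂ) ^ n * ((2 : ℂ) ^ n + 1))⁻¹ •
        ((1 : Matrix ((Fin n → Fin 2) × (Fin n → Fin 2))
            ((Fin n → Fin 2) × (Fin n → Fin 2)) ℂ) + swapMat (Fin n → Fin 2))
      - ((1 - ε : ℝ) : ℂ) • ∑ j, (w j : ℂ) • tsq (projVec (ψ j))).PosSemidef)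
    (hdes₂ : (((1 + ε : ℝ) : ℂ) • (∑ j, (w j : ℂ) • tsq (projVec (ψ j)))
      - ((2 : ℂ) ^ n * ((2 : ℂ) ^ n + 1))⁻¹ •
        ((1 : Matrix ((Fin n → Fin 2) × (Fin n → Fin 2))
            ((Fin n → Fin 2) × (Fin n → Fin 2)) ℂ) + swapMat (Fin n → Fin 2))).PosSemidef)
    (U : Matrix (Fin n → Fin 2) (Fin n → Fin 2) ℂ)
    (hU : U ∈ Matrix.unitaryGroup (Fin n → Fin 2) ℂ)
    (A : Finset (Fin n)) :
    ∑ j, w j * frobSq (ptrace A (U * projVec (ψ j) * Uᴴ) - ((2 : ℂ) ^ A.card)⁻¹ • 1)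
      ≤ 2 * (2 : ℝ) ^ A.card / 2 ^ n + 4 * ε := by
  set φ : J → (Fin n → Fin 2) → ℂ := fun j => U *ᵥ ψ j
  have hproj : ∀ j, U * projVec (ψ j) * Uᴴ = projVec (φ j) := fun j => (projVec_mulVec _ _).symm
  have hUU : Uᴴ * U = 1 := Matrix.mem_unitaryGroup_iff'.mp hU
  have hφ : ∀ j, (projVec (φ j)).trace = 1 := fun j => by
    rw [← hproj, Matrix.trace_mul_comm, ← mul_assoc, hUU, one_mul, trace_projVec, hψ]
  have hconj := posSemidef_design_conj hU hdes₁
  simp only [hproj] at hconj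
  have hpurity := marginal_purity_le n hw1 hφ hconj A
  have hle : ∑ j, w j * frobSq (ptrace A (projVec (φ j))) ≤ 1 := by
    rw [← hw1]
    exact Finset.sum_le_sum fun j _ =>
      mul_le_of_le_one_right (hw0 j) (frobSq_ptrace_projVec_le_one A (hφ j))
  have hfrob : ∀ j, frobSq (ptrace A (U * projVec (ψ j) * Uᴴ) - ((2 : ℂ) ^ A.card)⁻¹ • 1)
      = frobSq (ptrace A (projVec (φ j))) - ((2 : ℝ) ^ A.card)⁻¹ := fun j => by
    rw [hproj, ← frobSq_sub_smul_one (isHermitian_ptrace A (isHermitian_projVec (φ j)))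
      (by rw [trace_ptrace, hφ]) (by simp)]
    push_cast
    rfl
  have hn' : (2 : ℝ) ^ n = 2 ^ A.card * 2 ^ Aᶜ.card := by
    rw [← pow_add, Finset.card_add_card_compl, Fintype.card_fin]
  simp only [hfrob, mul_sub, Finset.sum_sub_distrib, ← Finset.sum_mul, hw1, one_mul, hn']
  exact purity_excess_le (one_le_pow₀ one_le_two) (one_le_pow₀ one_le_two) hε0 hle hpurity
end

section
/- Subset-average expansion for the quantum planted biclique states: fix integers d, n, t ≥ 1 and κ ∈ [0,1]. Let ρ be a d-dimensional density matrix, set Δ = ρ − I/d, and for T ⊆ [n] let (I/d) ⊗_T Δ denote the operator on (ℂ^d)^{⊗n} whose i-th tensor factor is Δ for i ∈ T and I/d for i ∉ T. For S ⊆ [n] define σ_{ρ,S} = κ·⊗_{i=1}^n (I/d + 1[i∈S]·Δ) + (1−κ)·(I/d)^{⊗n}, and let S be a random subset of [n] containing each element independently with probability κ. Then E_S[ σ_{ρ,S}^{⊗t} ] = Σ_{U ⊆ [t]} κ^{|U|} · Σ_{(T_ℓ)_{ℓ∈U}: each T_ℓ ⊆ [n] nonempty} κ^{|∪_{ℓ∈U}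 T_ℓ|} · M_U((T_ℓ)), where M_U((T_ℓ)) is the operator on ((ℂ^d)^{⊗n})^{⊗t} whose ℓ-th copy-factor equals (I/d)^{⊗n} for ℓ ∉ U and (I/d) ⊗_{T_ℓ} Δ for ℓ ∈ U. -/
open Matrix BigOperators Finset
open scoped ComplexOrder

/-- The `(x,y)` entry of the maximally mixed state `I/d` on `ℂ^d`. -/
noncomputable def mmEntry (d : ℕ) (x y : Fin d) : ℂ :=
  if x = y then (d : ℂ)⁻¹ else 0

/-- `(I/d) ⊗_T Δ`: the operator on `(ℂ^d)^{⊗n}` whose `i`-th tensor factor is `Δ` for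
`i ∈ T` and `I/d` for `i ∉ T`. -/
noncomputable def mixT {d n : ℕ} (Δ : Matrix (Fin d) (Fin d) ℂ) (T : Finset (Fin n)) :
    Matrix (Fin n → Fin d) (Fin n → Fin d) ℂ :=
  Matrix.of fun a a' =>
    ∏ i : Fin n, if i ∈ T then Δ (a i) (a' i) else mmEntry d (a i) (a' i)

/-- The quantum planted biclique state `σ_{ρ,S} = κ·⊗_{i=1}^n (I/d + 1[i∈S]·(ρ − I/d))
+ (1−κ)·(I/d)^{⊗n}`. -/
noncomputable def sigmaPB {d n : ℕ} (κ : ℝ) (ρ : Matrix (Fin d) (Fin d) ℂ)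
    (S : Finset (Fin n)) :
    Matrix (Fin n → Fin d) (Fin n → Fin d) ℂ :=
  Matrix.of fun a a' =>
    (κ : ℂ) * (∏ i : Fin n,
        (mmEntry d (a i) (a' i) +
          if i ∈ S then ρ (a i) (a' i) - mmEntry d (a i) (a' i) else 0))
      + ((1 - κ : ℝ) : ℂ) * ∏ i : Fin n, mmEntry d (a i) (a' i)

/-- The `t`-fold tensor power `M^{⊗t}` of an operator on `(ℂ^d)^{⊗n}`, acting on the
copies indexed by `Fin t × Fin n`. -/
noncomputable def cpow {d n : ℕ} (t : ℕ)
    (M : Matrix (Fin n → Fin d) (Fin n → Fin d) ℂ) :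
    Matrix (Fin t × Fin n → Fin d) (Fin t × Fin n → Fin d) ℂ :=
  Matrix.of fun f g => ∏ ℓ : Fin t, M (fun i => f (ℓ, i)) (fun i => g (ℓ, i))

/-- The operator `M_U((T_ℓ))` whose `ℓ`-th copy-factor equals `(I/d)^{⊗n}` for `ℓ ∉ U`
and `(I/d) ⊗_{T_ℓ} Δ` for `ℓ ∈ U`. -/
noncomputable def plantedTerm {d n : ℕ} (t : ℕ) (Δ : Matrix (Fin d) (Fin d) ℂ)
    (U : Finset (Fin t)) (Tf : Fin t → Finset (Fin n)) :
    Matrix (Fin t × Fin n → Fin d) (Fin t × Fin n → Fin d) ℂ :=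
  Matrix.of fun f g => ∏ ℓ : Fin t,
    if ℓ ∈ U then mixT Δ (Tf ℓ) (fun i => f (ℓ, i)) (fun i => g (ℓ, i))
    else ∏ i : Fin n, mmEntry d (f (ℓ, i)) (g (ℓ, i))

/-- The probability that a random subset with independent inclusion probability `p` contains
`V` is `p ^ #V`. -/
theorem sum_subset_weight {ι R : Type*} [Fintype ι] [DecidableEq ι] [CommRing R] (p : R)
    (V : Finset ι) :
    ∑ S : Finset ι, p ^ S.card * (1 - p) ^ (Fintype.card ι - S.card) *
      (if V ⊆ S then 1 else 0) = p ^ V.card := by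
  have h := Finset.prod_add (fun _ : ι => p) (fun i => if i ∉ V then 1 - p else 0) univ
  have h1 : ∀ i : ι, (p + if i ∉ V then 1 - p else 0) = if i ∈ V then p else 1 := by
    intro i
    split_ifs <;> simp_all
  simp only [h1, powerset_univ, Finset.prod_ite_zero, prod_const] at h
  rw [Finset.prod_ite_mem, univ_inter, prod_const] at h
  rw [h]
  refine sum_congr rfl fun S _ => ?_
  have h2 : (∀ i ∈ univ \ S, i ∉ V) ↔ V ⊆ S := by
    simp only [mem_sdiff, mem_univ, true_and, subset_iff]
    exact forall_congr' fun i => not_imp_not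
  simp only [h2, card_univ_sdiff, mul_ite, mul_one, mul_zero]

/-- Expanding a product of two-term factors whose first term is present only on `S`. -/
theorem prod_add_ite_eq_sum {ι R : Type*} [Fintype ι] [DecidableEq ι] [CommRing R]
    (m D : ι → R) (S : Finset ι) :
    ∏ i, (m i + if i ∈ S then D i else 0) =
      ∑ T : Finset ι, (if T ⊆ S then 1 else 0) * ∏ i, if i ∈ T then D i else m i := by
  simp only [add_comm (m _)]
  rw [Finset.prod_add, powerset_univ]
  refine sum_congr rfl fun T _ => ?_
  rw [Finset.prod_ite_zero, Finset.prod_ite, filter_mem_eq_inter, univ_inter,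
    filter_notMem_eq_sdiff, ite_mul, ite_mul, one_mul, zero_mul, zero_mul]
  rfl

/-- The planted state as a combination of the operators `(I/d) ⊗_T Δ`. -/
theorem sigmaPB_apply {d n : ℕ} (κ : ℝ) (ρ : Matrix (Fin d) (Fin d) ℂ) (S : Finset (Fin n))
    (a b : Fin n → Fin d) :
    sigmaPB κ ρ S a b = ∑ T : Finset (Fin n),
      ((if T.Nonempty then (κ : ℂ) else 1) * (if T ⊆ S then 1 else 0)) *
        mixT (ρ - (d : ℂ)⁻¹ • 1) T a b := by
  have hΔ : ∀ x y, (ρ - (d : ℂ)⁻¹ • (1 : Matrix (Fin d) (Fin d) ℂ)) x y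
      = ρ x y - mmEntry d x y := by
    intro x y
    simp [mmEntry, Matrix.one_apply]
  simp only [sigmaPB, mixT, of_apply, hΔ]
  have hm : ∏ i, mmEntry d (a i) (b i) = ∑ T : Finset (Fin n), if T = ∅ then
      ∏ i, (if i ∈ T then ρ (a i) (b i) - mmEntry d (a i) (b i) else mmEntry d (a i) (b i))
      else 0 := by
    simp
  rw [prod_add_ite_eq_sum, hm, mul_sum, mul_sum, ← sum_add_distrib]
  refine sum_congr rfl fun T _ => ?_
  rcases T.eq_empty_or_nonempty with rfl | h
  · simp only [empty_subset, Finset.not_nonempty_empty, if_true, if_false]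
    push_cast
    ring
  · rw [if_pos h, if_neg h.ne_empty]
    ring

/-- The operator `M_U((T_ℓ))` is a product of the `(I/d) ⊗_{T_ℓ} Δ` when `T_ℓ = ∅` off `U`. -/
theorem plantedTerm_apply {d n t : ℕ} (Δ : Matrix (Fin d) (Fin d) ℂ) {U : Finset (Fin t)}
    {Tf : Fin t → Finset (Fin n)} (h : ∀ ℓ ∉ U, Tf ℓ = ∅) (f g : Fin t × Fin n → Fin d) :
    plantedTerm t Δ U Tf f g =
      ∏ ℓ, mixT Δ (Tf ℓ) (fun i => f (ℓ, i)) (fun i => g (ℓ, i)) := by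
  rw [plantedTerm, of_apply]
  refine prod_congr rfl fun ℓ _ => ?_
  split_ifs with hℓ
  · rfl
  · simp [mixT, h ℓ hℓ]

/-- subset-average expansion for the quantum planted biclique states. -/
theorem planted_biclique_subset_average_expansion
    (d n t : ℕ) (hd : 1 ≤ d) (hn : 1 ≤ n) (ht : 1 ≤ t)
    (κ : ℝ) (hκ0 : 0 ≤ κ) (hκ1 : κ ≤ 1)
    (ρ : Matrix (Fin d) (Fin d) ℂ) (hρ : ρ.PosSemidef) (htrρ : ρ.trace = 1) :
    ∑ S : Finset (Fin n),
        ((κ ^ S.card * (1 - κ) ^ (n - S.card) : ℝ) : ℂ) • cpow t (sigmaPB κ ρ S)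
      = ∑ U : Finset (Fin t), ∑ Tf : Fin t → Finset (Fin n),
          (if (∀ ℓ ∈ U, (Tf ℓ).Nonempty) ∧ (∀ ℓ ∉ U, Tf ℓ = ∅) then
              ((κ ^ U.card : ℝ) : ℂ) * ((κ ^ (U.sup Tf).card : ℝ) : ℂ)
            else 0) •
            plantedTerm t (ρ - (d : ℂ)⁻¹ • 1) U Tf := by
  classical
  ext f g
  set Δ := ρ - (d : ℂ)⁻¹ • (1 : Matrix (Fin d) (Fin d) ℂ)
  let P (Tf : Fin t → Finset (Fin n)) : ℂ :=
    ∏ ℓ, mixT Δ (Tf ℓ) (fun i => f (ℓ, i)) (fun i => g (ℓ, i))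
  let N (Tf : Fin t → Finset (Fin n)) : Finset (Fin t) := univ.filter fun ℓ => (Tf ℓ).Nonempty
  have hN : ∀ U Tf, ((∀ ℓ ∈ U, (Tf ℓ).Nonempty) ∧ (∀ ℓ ∉ U, Tf ℓ = ∅)) ↔ U = N Tf := by
    intro U Tf
    constructor
    · rintro ⟨h1, h2⟩
      ext ℓ
      simp only [N, mem_filter, mem_univ, true_and]
      refine ⟨h1 ℓ, fun h => ?_⟩
      by_contra hℓ
      exact h.ne_empty (h2 ℓ hℓ)
    · rintro rfl
      simp [N]
  have hsup : ∀ Tf : Fin t → Finset (Fin n), (N Tf).sup Tf = univ.sup Tf := by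
    intro Tf
    refine le_antisymm (sup_mono (subset_univ _)) (Finset.sup_le fun ℓ _ => ?_)
    rcases (Tf ℓ).eq_empty_or_nonempty with h | h
    · simp [h]
    · exact le_sup (f := Tf) (by simpa [N] using h)
  have hcpow : ∀ S, cpow t (sigmaPB κ ρ S) f g = ∑ Tf : Fin t → Finset (Fin n),
      (κ : ℂ) ^ (N Tf).card * (if univ.sup Tf ⊆ S then 1 else 0) * P Tf := by
    intro S
    simp only [cpow, of_apply, sigmaPB_apply]
    rw [Finset.prod_univ_sum, Fintype.piFinset_univ]
    refine sum_congr rfl fun Tf _ => ?_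
    rw [prod_mul_distrib, prod_mul_distrib, Finset.prod_ite_zero, ← prod_filter, prod_const]
    have h : (∀ ℓ ∈ univ, Tf ℓ ⊆ S) ↔ univ.sup Tf ⊆ S := Finset.sup_le_iff.symm
    simp only [h, prod_const_one]
    rfl
  have hR : ∀ Tf : Fin t → Finset (Fin n), ∑ U : Finset (Fin t),
      (if (∀ ℓ ∈ U, (Tf ℓ).Nonempty) ∧ (∀ ℓ ∉ U, Tf ℓ = ∅) then
        ((κ ^ U.card : ℝ) : ℂ) * ((κ ^ (U.sup Tf).card : ℝ) : ℂ) else 0) *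
          plantedTerm t Δ U Tf f g
      = (κ : ℂ) ^ (N Tf).card * (κ : ℂ) ^ (univ.sup Tf).card * P Tf := by
    intro Tf
    simp only [hN, ite_mul, zero_mul, sum_ite_eq', mem_univ, if_true, hsup]
    rw [plantedTerm_apply Δ ((hN _ _).2 rfl).2]
    push_cast
    rfl
  simp only [Matrix.sum_apply, Matrix.smul_apply, smul_eq_mul, hcpow]
  rw [sum_comm (s := (univ : Finset (Finset (Fin t)))), sum_congr rfl fun Tf _ => hR Tf]
  simp only [mul_sum]
  rw [sum_comm]
  refine sum_congr rfl fun Tf _ => ?_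
  rw [← sum_subset_weight (κ : ℂ) (univ.sup Tf), Fintype.card_fin, mul_sum, sum_mul]
  refine sum_congr rfl fun S _ => ?_
  push_cast
  ring
end

section
/- Central moment expansion for exact state designs: let d, t ≥ 1 and let ν be a finitely supported probability distribution on unit vectors ψ ∈ ℂ^d that is an exact state t-design. Then E_{ψ∼ν}[ (d·ψψ^* − I)^{⊗t} ] = Σ_{π ∈ S_t} γ_{|fix(π)|} · P_π, where fix(π) ⊆ [t] is the set of fixed points of π, γ_f = Σ_{r=0}^f (−1)^r · C(f,r) · β_{d,t−r}, and β_{d,s} = d^s / (d(d+1)⋯(d+s−1)). -/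
open Matrix BigOperators Finset
open scoped ComplexOrder

/-- The `u`-fold tensor power `M^{⊗u}` of a `d × d` matrix. -/
noncomputable def tpow {d : ℕ} (u : ℕ) (M : Matrix (Fin d) (Fin d) ℂ) :
    Matrix (Fin u → Fin d) (Fin u → Fin d) ℂ :=
  Matrix.of fun f g => ∏ ℓ : Fin u, M (f ℓ) (g ℓ)

/-- The operator permuting the tensor factors of `(ℂ^d)^{⊗u}` according to `π`,
i.e. `P_π(v_1⊗⋯⊗v_u) = v_{π⁻¹(1)}⊗⋯⊗v_{π⁻¹(u)}`. -/
noncomputable def permMat {d u : ℕ} (π : Equiv.Perm (Fin u)) :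
    Matrix (Fin u → Fin d) (Fin u → Fin d) ℂ :=
  Matrix.of fun f g => if ∀ ℓ, f (π ℓ) = g ℓ then 1 else 0

/-- Number of fixed points of a permutation. -/
def fixCount {u : ℕ} (π : Equiv.Perm (Fin u)) : ℕ :=
  (Finset.univ.filter fun ℓ => π ℓ = ℓ).card

/-- `β_{d,s} = d^s / (d(d+1)⋯(d+s−1))`. -/
noncomputable def betaC (d s : ℕ) : ℝ :=
  (d : ℝ) ^ s / ∏ i ∈ Finset.range s, ((d : ℝ) + i)

/-- `γ_f = Σ_{r=0}^f (−1)^r C(f,r) β_{d,t−r}`. -/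
noncomputable def gammaC (d t f : ℕ) : ℝ :=
  ∑ r ∈ Finset.range (f + 1), (-1 : ℝ) ^ r * (f.choose r) * betaC d (t - r)

/-- The mixed moments of a design, indexed by an arbitrary finite type of tensor factors. -/
theorem sum_prod_projVec_eq_sum_perm {d t : ℕ} {J : Type} [Fintype J] {w : J → ℝ}
    (hw1 : ∑ j, w j = 1) {ψ : J → Fin d → ℂ}
    (hdesign : ∀ u : ℕ, 1 ≤ u → u ≤ t →
      ∑ j, (w j : ℂ) • tpow u (projVec (ψ j))
        = (∏ i ∈ Finset.range u, ((d : ℂ) + i))⁻¹ •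
            ∑ π : Equiv.Perm (Fin u), permMat π)
    {α : Type*} [Fintype α] [DecidableEq α] (hα : Fintype.card α ≤ t) (F G : α → Fin d) :
    ∑ j, (w j : ℂ) * ∏ a, projVec (ψ j) (F a) (G a)
      = (∏ i ∈ Finset.range (Fintype.card α), ((d : ℂ) + i))⁻¹ *
          ∑ σ : Equiv.Perm α, if ∀ a, F (σ a) = G a then 1 else 0 := by
  rcases Nat.eq_zero_or_pos (Fintype.card α) with h0 | h0
  · have := Fintype.card_eq_zero_iff.mp h0
    have hw : ∑ j, (w j : ℂ) = 1 := by exact_mod_cast hw1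
    simp [hw]
  · let e := Fintype.equivFin α
    have key := congrFun (congrFun (hdesign _ h0 hα) (F ∘ e.symm)) (G ∘ e.symm)
    simp only [Matrix.sum_apply, Matrix.smul_apply, tpow, permMat, Matrix.of_apply,
      smul_eq_mul, Function.comp_apply] at key
    have hprod : ∀ j, ∏ a, projVec (ψ j) (F a) (G a)
        = ∏ ℓ, projVec (ψ j) (F (e.symm ℓ)) (G (e.symm ℓ)) := fun j =>
      (Equiv.prod_comp e.symm fun a => projVec (ψ j) (F a) (G a)).symm
    simp only [hprod, key]
    congr 1
    refine Fintype.sum_equiv e.symm.permCongr _ _ fun σ => ?_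
    congr 1
    refine propext ⟨fun h a => by simpa using h (e a), fun h ℓ => by simpa using h (e.symm ℓ)⟩

/-- Extending a permutation by the identity on `R` turns the sum over permutations of the
complement of `R` into a sum over permutations fixing `R` pointwise. -/
theorem sum_perm_compl_mul_prod_eq {α β : Type*} [Fintype α] [DecidableEq α] [DecidableEq β]
    (R : Finset α) (f g : α → β) :
    (∑ σ : Equiv.Perm {a // a ∉ R}, if ∀ a, f (σ a) = g a then (1 : ℂ) else 0) *
        ∏ a ∈ R, (if f a = g a then (1 : ℂ) else 0)
      = ∑ π : Equiv.Perm α, if R ⊆ univ.filter (fun a => π a = a) then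
          (if ∀ a, f (π a) = g a then (1 : ℂ) else 0) else 0 := by
  rw [← Finset.sum_filter (fun π : Equiv.Perm α => R ⊆ univ.filter (fun a => π a = a)),
    Finset.sum_subtype (p := fun π : Equiv.Perm α => ∀ a, ¬ a ∉ R → π a = a) _
      (fun π => by simp only [Finset.subset_iff, Finset.mem_filter_univ, not_not]),
    Finset.prod_ite_zero, Finset.prod_const_one, Finset.sum_mul]
  refine Fintype.sum_equiv (Equiv.Perm.subtypeEquivSubtypePerm fun a => a ∉ R) _ _ fun σ => ?_
  rw [ite_zero_mul_ite_zero, mul_one]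
  congr 1
  refine propext ⟨fun h a => ?_, fun h => ⟨fun a => ?_, fun a ha => ?_⟩⟩
  · by_cases ha : a ∈ R
    · rw [Equiv.Perm.subtypeEquivSubtypePerm_apply_of_not_mem (p := fun a => a ∉ R) _ (not_not.mpr ha)]
      exact h.2 a ha
    · rw [Equiv.Perm.subtypeEquivSubtypePerm_apply_of_mem (p := fun a => a ∉ R) _ ha]
      exact h.1 ⟨a, ha⟩
  · rw [← h a, Equiv.Perm.subtypeEquivSubtypePerm_apply_of_mem (p := fun a => a ∉ R) _ a.2]
  · rw [← h a, Equiv.Perm.subtypeEquivSubtypePerm_apply_of_not_mem (p := fun a => a ∉ R) _ (not_not.mpr ha)]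

theorem gammaC_fixCount_eq_sum_powerset (d : ℕ) {t : ℕ} (π : Equiv.Perm (Fin t)) :
    gammaC d t (fixCount π)
      = ∑ R ∈ (univ.filter fun ℓ => π ℓ = ℓ).powerset, (-1 : ℝ) ^ #R * betaC d (t - #R) := by
  rw [Finset.sum_powerset_apply_card (fun r => (-1 : ℝ) ^ r * betaC d (t - r))]
  refine Finset.sum_congr rfl fun r _ => ?_
  rw [nsmul_eq_mul, fixCount]
  ring

/-- central moment expansion for exact state designs:
`E_ψ[(d·ψψ^* − I)^{⊗t}] = Σ_{π∈S_t} γ_{|fix(π)|} P_π`. -/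
theorem exact_design_central_moment_expansion
    (d t : ℕ) (hd : 1 ≤ d) (ht : 1 ≤ t)
    (J : Type) [Fintype J] (w : J → ℝ) (hw0 : ∀ j, 0 ≤ w j) (hw1 : ∑ j, w j = 1)
    (ψ : J → Fin d → ℂ) (hψ : ∀ j, star (ψ j) ⬝ᵥ ψ j = 1)
    (hdesign : ∀ u : ℕ, 1 ≤ u → u ≤ t →
      ∑ j, (w j : ℂ) • tpow u (projVec (ψ j))
        = (∏ i ∈ Finset.range u, ((d : ℂ) + i))⁻¹ •
            ∑ π : Equiv.Perm (Fin u), permMat π) :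
    ∑ j, (w j : ℂ) • tpow t ((d : ℂ) • projVec (ψ j) - 1)
      = ∑ π : Equiv.Perm (Fin t), ((gammaC d t (fixCount π) : ℝ) : ℂ) • permMat π := by
  ext f g
  simp only [Matrix.sum_apply, Matrix.smul_apply, tpow, Matrix.of_apply, smul_eq_mul,
    Matrix.sub_apply, Matrix.one_apply, permMat]
  have hterm : ∀ R : Finset (Fin t),
      ∑ j, (w j : ℂ) * ((-1) ^ #R * (∏ ℓ ∈ univ \ R, (d : ℂ) * projVec (ψ j) (f ℓ) (g ℓ)) *
          ∏ ℓ ∈ R, (if f ℓ = g ℓ then (1 : ℂ) else 0))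
        = ∑ π : Equiv.Perm (Fin t), if R ⊆ univ.filter (fun ℓ => π ℓ = ℓ) then
            (((-1 : ℝ) ^ #R * betaC d (t - #R) : ℝ) : ℂ) *
              (if ∀ ℓ, f (π ℓ) = g ℓ then (1 : ℂ) else 0) else 0 := by
    intro R
    have hcard : Fintype.card {ℓ // ℓ ∉ R} = t - #R := by simp
    have hmoment := sum_prod_projVec_eq_sum_perm hw1 hdesign
      (α := {ℓ // ℓ ∉ R}) (hcard.trans_le (Nat.sub_le _ _)) (fun a => f a) (fun a => g a)
    have hprod : ∀ j, ∏ ℓ ∈ univ \ R, (d : ℂ) * projVec (ψ j) (f ℓ) (g ℓ)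
        = (d : ℂ) ^ (t - #R) * ∏ a : {ℓ // ℓ ∉ R}, projVec (ψ j) (f a) (g a) := by
      intro j
      rw [Finset.prod_subtype (p := fun ℓ => ℓ ∉ R) _ (by simp), Finset.prod_mul_distrib,
        Finset.prod_const, Finset.card_univ, hcard]
    have hbeta : ((betaC d (t - #R) : ℝ) : ℂ)
        = (d : ℂ) ^ (t - #R) * (∏ i ∈ Finset.range (t - #R), ((d : ℂ) + i))⁻¹ := by
      simp [betaC, div_eq_mul_inv]
    rw [hcard] at hmoment
    calc _ = (-1) ^ #R * (d : ℂ) ^ (t - #R) *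
          (∑ j, (w j : ℂ) * ∏ a : {ℓ // ℓ ∉ R}, projVec (ψ j) (f a) (g a)) *
            ∏ ℓ ∈ R, (if f ℓ = g ℓ then (1 : ℂ) else 0) := by
          rw [Finset.mul_sum, Finset.sum_mul]
          refine Finset.sum_congr rfl fun j _ => ?_
          rw [hprod]
          ring
      _ = (((-1 : ℝ) ^ #R * betaC d (t - #R) : ℝ) : ℂ) *
          ((∑ σ : Equiv.Perm {ℓ // ℓ ∉ R}, if ∀ a, f (σ a) = g a then (1 : ℂ) else 0) *
            ∏ ℓ ∈ R, (if f ℓ = g ℓ then (1 : ℂ) else 0)) := by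
          rw [hmoment]
          push_cast
          rw [hbeta]
          ring
      _ = _ := by
          rw [sum_perm_compl_mul_prod_eq, Finset.mul_sum]
          simp only [mul_ite, mul_zero]
  simp only [Finset.prod_sub, Finset.mul_sum]
  rw [Finset.sum_comm, Finset.sum_congr rfl fun R _ => hterm R, Finset.sum_comm]
  refine Finset.sum_congr rfl fun π _ => ?_
  rw [gammaC_fixCount_eq_sum_powerset, Complex.ofReal_sum, Finset.sum_mul, ← Finset.sum_filter]
  exact Finset.sum_congr (by ext R; simp) fun _ _ => rfl
end

section
/- Cancellation bound for design moment coefficients: define β_{d,s} = d^s / (d(d+1)⋯(d+s−1)) and, for integers 0 ≤ f ≤ t, γ_f = Σ_{r=0}^f (−1)^r · C(f,r) · β_{d,t−r}. Then γ_0 = d^t/(d(d+1)⋯(d+t−1)), and there is an absolute constant C such that for all integers d, t, f with 1 ≤ f ≤ t and 8t² ≤ d, one has |γ_f| ≤ (C·t/√d)^f. -/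
open BigOperators Finset

theorem gammaC_zero (d t : ℕ) : gammaC d t 0 = betaC d t := by
  simp [gammaC]

theorem gammaC_succ_succ (d t f : ℕ) :
    gammaC d (t + 1) (f + 1) = gammaC d (t + 1) f - gammaC d t f := by
  have h : gammaC d (t + 1) f = ∑ r ∈ Finset.range (f + 2),
      (-1 : ℝ) ^ r * (f.choose r) * betaC d (t + 1 - r) := by
    rw [Finset.sum_range_succ]
    simp [gammaC]
  rw [h, Finset.sum_range_succ']
  unfold gammaC
  rw [Finset.sum_range_succ', add_sub_right_comm, ← Finset.sum_sub_distrib]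
  congr 1
  · refine Finset.sum_congr rfl fun r _ => ?_
    rw [Nat.choose_succ_succ, Nat.add_sub_add_right]
    push_cast
    ring
  · simp

theorem betaC_succ {d : ℕ} (hd : 0 < d) (s : ℕ) :
    ((d : ℝ) + s) * betaC d (s + 1) = d * betaC d s := by
  have hd' : (0 : ℝ) < d := by exact_mod_cast hd
  have hs : (d : ℝ) + s ≠ 0 := by positivity
  have hp : ∏ i ∈ Finset.range s, ((d : ℝ) + i) ≠ 0 :=
    Finset.prod_ne_zero_iff.mpr fun i _ => by positivity
  unfold betaC
  rw [Finset.prod_range_succ, pow_succ]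
  field_simp

theorem betaC_nonneg (d s : ℕ) : 0 ≤ betaC d s := by
  unfold betaC
  positivity

theorem betaC_le_one (d s : ℕ) : betaC d s ≤ 1 := by
  unfold betaC
  refine div_le_one_of_le₀ ?_ (by positivity)
  calc (d : ℝ) ^ s = ∏ i ∈ Finset.range s, (d : ℝ) := by simp
    _ ≤ _ := Finset.prod_le_prod (fun _ _ => by positivity) fun i _ => by
      have : (0 : ℝ) ≤ i := by positivity
      linarith

theorem gammaC_one {d : ℕ} (hd : 0 < d) (t : ℕ) :
    d * gammaC d (t + 1) 1 = -(t * gammaC d (t + 1) 0) := by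
  rw [gammaC_succ_succ, gammaC_zero, gammaC_zero]
  linarith [betaC_succ hd t]

/-- Three-term recurrence in `f`, at fixed `t`. -/
theorem gammaC_recurrence {d : ℕ} (hd : 0 < d) (f k : ℕ) :
    d * gammaC d (f + k + 2) (f + 2) =
      -(k * gammaC d (f + k + 2) (f + 1) + (f + 1) * gammaC d (f + k + 2) f) := by
  induction f generalizing k with
  | zero =>
    have h1 := gammaC_one hd (k + 1)
    have h2 := gammaC_one hd k
    have h3 := gammaC_succ_succ d (k + 1) 1
    have h4 := gammaC_succ_succ d (k + 1) 0
    norm_num [add_assoc] at h1 h2 h3 h4 ⊢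
    rw [h3, mul_sub, h1, h2, h4]
    ring
  | succ f ih =>
    have h1 := ih (k + 1)
    have h2 := ih k
    have h3 := gammaC_succ_succ d (f + k + 2) (f + 2)
    have h4 := gammaC_succ_succ d (f + k + 2) (f + 1)
    have h5 := gammaC_succ_succ d (f + k + 2) f
    rw [show f + (k + 1) + 2 = f + k + 2 + 1 by ring] at h1
    rw [show f + 1 + k + 2 = f + k + 2 + 1 by ring, show f + 1 + 2 = f + 2 + 1 by ring,
      show f + 1 + 1 = f + 2 by ring, h3, mul_sub, h1, h2, h4, h5]
    push_cast
    ring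

theorem abs_gammaC_le_pow {d t : ℕ} (ht : 1 ≤ t) (htd : 8 * t ^ 2 ≤ d) (f : ℕ) (hf : f ≤ t) :
    |gammaC d t f| ≤ (2 * (t : ℝ) / Real.sqrt d) ^ f := by
  have hd : 0 < d := by nlinarith
  have hdR : (0 : ℝ) < d := by exact_mod_cast hd
  have htR : (1 : ℝ) ≤ t := by exact_mod_cast ht
  have htdR : 8 * (t : ℝ) ^ 2 ≤ d := by exact_mod_cast htd
  set x : ℝ := 2 * (t : ℝ) / Real.sqrt d with hx
  have hx0 : 0 < x := by positivity
  have hx2 : d * x ^ 2 = 4 * (t : ℝ) ^ 2 := by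
    rw [hx, div_pow, Real.sq_sqrt hdR.le]
    field_simp
    norm_num
  have hx1 : x ≤ 1 := by
    have h : d * x ^ 2 ≤ d * 1 := by nlinarith
    exact (sq_le_one_iff₀ hx0.le).mp (le_of_mul_le_mul_left h hdR)
  have hstep : t * (x + 1) ≤ d * x ^ 2 := by nlinarith
  have h0 : |gammaC d t 0| ≤ 1 := by
    rw [gammaC_zero, abs_of_nonneg (betaC_nonneg d t)]
    exact betaC_le_one d t
  induction f using Nat.twoStepInduction with
  | zero => simpa using h0
  | one =>
    obtain ⟨s, rfl⟩ := Nat.exists_eq_add_of_le' ht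
    have h := congrArg abs (gammaC_one hd s)
    rw [abs_neg, abs_mul, abs_mul, abs_of_pos hdR, Nat.abs_cast] at h
    have hs : (0 : ℝ) ≤ s := by positivity
    push_cast at *
    rw [pow_one]
    refine le_of_mul_le_mul_left ?_ hdR
    rw [h]
    calc s * |gammaC d (s + 1) 0| ≤ s * 1 := by gcongr
      _ ≤ d * x ^ 2 := by nlinarith
      _ ≤ d * x := by
        gcongr
        exact pow_le_of_le_one hx0.le hx1 two_ne_zero
  | more f ih0 ih1 =>
    obtain ⟨k, hk⟩ := Nat.exists_eq_add_of_le hf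
    have h := gammaC_recurrence hd f k
    rw [show f + k + 2 = t by omega] at h
    replace h := congrArg abs h
    rw [abs_neg, abs_mul, abs_of_pos hdR] at h
    have hkt : (k : ℝ) ≤ t := by exact_mod_cast (by omega : k ≤ t)
    have hft : (f : ℝ) + 1 ≤ t := by exact_mod_cast (by omega : f + 1 ≤ t)
    refine le_of_mul_le_mul_left ?_ hdR
    calc d * |gammaC d t (f + 2)|
        ≤ |k * gammaC d t (f + 1)| + |(f + 1) * gammaC d t f| := h ▸ abs_add_le _ _
      _ = k * |gammaC d t (f + 1)| + (f + 1) * |gammaC d t f| := by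
          rw [abs_mul, abs_mul, Nat.abs_cast, abs_of_nonneg (by positivity : (0 : ℝ) ≤ f + 1)]
      _ ≤ t * x ^ (f + 1) + t * x ^ f := by
          gcongr
          · exact ih1 (by omega)
          · exact ih0 (by omega)
      _ = t * (x + 1) * x ^ f := by ring
      _ ≤ d * x ^ 2 * x ^ f := by gcongr
      _ = d * x ^ (f + 2) := by ring

/-- cancellation bound for design moment coefficients:
`γ_0 = d^t/(d(d+1)⋯(d+t−1))`, and there is an absolute constant `C` such that
`|γ_f| ≤ (C·t/√d)^f` whenever `1 ≤ f ≤ t` and `8t² ≤ d`. -/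
theorem design_moment_coefficient_cancellation :
    (∀ d t : ℕ, gammaC d t 0 = (d : ℝ) ^ t / ∏ i ∈ Finset.range t, ((d : ℝ) + i)) ∧
    ∃ C : ℝ, 0 < C ∧
      ∀ d t f : ℕ, 1 ≤ f → f ≤ t → 8 * t ^ 2 ≤ d →
        |gammaC d t f| ≤ (C * (t : ℝ) / Real.sqrt d) ^ f := by
  refine ⟨fun d t => gammaC_zero d t, 2, two_pos, fun d t f hf hft htd => ?_⟩
  exact abs_gammaC_le_pow (hf.trans hft) htd f hft
end

section
/- Derangement overlap bound: let d ≥ 1, let W be a finite set, for each w ∈ W let (ψ^w_x)_{x ∈ [d]} be an orthonormal basis of ℂ^d, and let π be a permutation of W with no fixed points. Then (1/d^{|W|}) · Σ_{x : W → [d]} ∏_{w ∈ W} |⟨ψ^w_{x(w)}, ψ^{π(w)}_{x(π(w))}⟩|² ≤ d^{−|W|/2}. -/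
open Matrix BigOperators Finset

/-- Parseval's identity for an orthonormal basis in the sense of `IsONB`. -/
lemma IsONB.sum_norm_sq {ι : Type*} [Fintype ι] [DecidableEq ι] {φ : ι → ι → ℂ}
    (hφ : IsONB φ) (v : ι → ℂ) (hv : star v ⬝ᵥ v = 1) :
    ∑ c, ‖star (φ c) ⬝ᵥ v‖ ^ 2 = 1 := by
  set U : Matrix ι ι ℂ := Matrix.of fun c => star (φ c) with hU
  have h1 : U * Uᴴ = 1 := by
    ext s t
    have h := hφ s t
    simpa [hU, Matrix.mul_apply, Matrix.one_apply, dotProduct] using h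
  have h2 : Uᴴ * U = 1 := mul_eq_one_comm.mp h1
  have h3 : star (U *ᵥ v) ⬝ᵥ (U *ᵥ v) = 1 := by
    rw [Matrix.star_mulVec, Matrix.dotProduct_mulVec, Matrix.vecMul_vecMul, h2,
      Matrix.vecMul_one, hv]
  have h4 : ((∑ c, ‖star (φ c) ⬝ᵥ v‖ ^ 2 : ℝ) : ℂ) = 1 := by
    rw [← h3]
    push_cast
    refine Finset.sum_congr rfl fun c _ => ?_
    exact (Complex.conj_mul' _).symm
  exact_mod_cast h4

lemma sum_sum_update {W α : Type*} [Fintype W] [DecidableEq W] [Fintype α]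
    (a : W) (F : (W → α) → ℝ) :
    ∑ x : W → α, ∑ c, F (Function.update x a c) = Fintype.card α * ∑ x, F x := by
  have h : ∑ p : (W → α) × α, F (Function.update p.1 a p.2) =
      ∑ p : (W → α) × α, F p.1 := by
    have hinv : Function.Involutive
        (fun p : (W → α) × α => (Function.update p.1 a p.2, p.1 a)) := by
      rintro ⟨x, c⟩
      simp
    exact Equiv.sum_comp hinv.toPerm fun p => F p.1
  rw [Fintype.sum_prod_type, Fintype.sum_prod_type] at h
  rw [h]
  simp [Finset.mul_sum]

/-- Summing a product of column-stochastic weights along the edges `w → f w`, `w ∈ A`,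
when these edges contain no cycle. -/
lemma card_pow_mul_sum_prod_of_rank {W α : Type*} [Fintype W] [DecidableEq W] [Fintype α]
    (M : W → α → α → ℝ) (hM : ∀ w t, ∑ c, M w c t = 1) (f : W → W) (h : W → ℕ)
    (A : Finset W) (hA : ∀ w ∈ A, h (f w) < h w) :
    (Fintype.card α : ℝ) ^ #A * ∑ x : W → α, ∏ w ∈ A, M w (x w) (x (f w)) =
      (Fintype.card α : ℝ) ^ Fintype.card W := by
  induction A using Finset.induction_on_max_value h with
  | empty => simp
  | insert a s ha hmax ih =>
    have ih' := ih fun w hw => hA w (mem_insert_of_mem hw)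
    have hfa : f a ≠ a := fun e => by
      have := hA a (mem_insert_self a s)
      rw [e] at this
      exact lt_irrefl _ this
    rw [card_insert_of_notMem ha, pow_succ, mul_assoc, ← sum_sum_update a, ← ih']
    congr 1
    refine Finset.sum_congr rfl fun x _ => ?_
    have hG : ∀ c, ∏ w ∈ s, M w (Function.update x a c w) (Function.update x a c (f w)) =
        ∏ w ∈ s, M w (x w) (x (f w)) := fun c => by
      refine Finset.prod_congr rfl fun w hw => ?_
      have h1 : w ≠ a := fun e => ha (e ▸ hw)
      have h2 : f w ≠ a := fun e => by
        have := hA w (mem_insert_of_mem hw)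
        rw [e] at this
        exact absurd (hmax w hw) (not_le.mpr this)
      rw [Function.update_of_ne h1, Function.update_of_ne h2]
    simp_rw [prod_insert ha, hG, Function.update_self, Function.update_of_ne hfa]
    rw [← Finset.sum_mul, hM, one_mul]

/-- A fixed-point-free permutation admits a set containing at most half of the points
that meets every cycle. -/
lemma exists_cycle_transversal {W : Type*} [Fintype W] [DecidableEq W]
    (π : Equiv.Perm W) (hπ : ∀ w, π w ≠ w) :
    ∃ R : Finset W, 2 * #R ≤ Fintype.card W ∧ ∀ w, ∃ k : ℕ, (π ^ k) w ∈ R := by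
  classical
  let S := Equiv.Perm.SameCycle.setoid π
  let r : W → W := fun w => (Quotient.mk S w).out
  have hr : ∀ w, π.SameCycle w (r w) := fun w => (Quotient.mk_out (s := S) w).symm
  have hrr : ∀ v w, π.SameCycle v w → r v = r w := fun v w hvw =>
    congrArg Quotient.out (Quotient.sound (s := S) hvw)
  refine ⟨univ.image r, ?_, fun w => ?_⟩
  · have hdisj : Disjoint (univ.image r) ((univ.image r).map π.toEmbedding) := by
      rw [Finset.disjoint_left]
      intro u hu hu'
      simp only [mem_image, mem_univ, true_and, mem_map, Equiv.coe_toEmbedding,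
        exists_exists_eq_and] at hu hu'
      obtain ⟨v, rfl⟩ := hu
      obtain ⟨w, hw⟩ := hu'
      have h1 : π.SameCycle (r w) (r v) := ⟨1, by simpa using hw⟩
      have h2 : r w = r v := hrr w v (((hr w).trans h1).trans (hr v).symm)
      exact hπ (r w) (hw.trans h2.symm)
    have := Finset.card_le_univ ((univ.image r).disjUnion _ hdisj)
    rw [card_disjUnion, card_map] at this
    omega
  · obtain ⟨k, hk⟩ := (hr w).exists_nat_pow_eq
    exact ⟨k, hk ▸ mem_image_of_mem r (mem_univ w)⟩

/-- derangement overlap bound. For orthonormal bases `(ψ^w_x)_x` of `ℂ^d`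
indexed by `w ∈ W` and a fixed-point-free permutation `π` of `W`,
`E_x ∏_w |⟨ψ^w_{x(w)}, ψ^{π(w)}_{x(π(w))}⟩|² ≤ d^{−|W|/2}`. -/
theorem derangement_overlap_bound
    (d : ℕ) (hd : 1 ≤ d) (W : Type) [Fintype W] [DecidableEq W]
    (ψ : W → Fin d → Fin d → ℂ) (hψ : ∀ w, IsONB (ψ w))
    (π : Equiv.Perm W) (hπ : ∀ w, π w ≠ w) :
    (1 / (d : ℝ) ^ (Fintype.card W)) *
        ∑ x : W → Fin d,
          ∏ w : W, ‖star (ψ w (x w)) ⬝ᵥ ψ (π w) (x (π w))‖ ^ 2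
      ≤ (d : ℝ) ^ (-(Fintype.card W : ℝ) / 2) := by
  have hcol : ∀ w t, ∑ c, ‖star (ψ w c) ⬝ᵥ ψ (π w) t‖ ^ 2 = 1 := fun w t =>
    (hψ w).sum_norm_sq _ (by simpa using hψ (π w) t t)
  have hle : ∀ w s t, ‖star (ψ w s) ⬝ᵥ ψ (π w) t‖ ^ 2 ≤ 1 := fun w s t => by
    rw [← hcol w t]
    exact Finset.single_le_sum (f := fun c => ‖star (ψ w c) ⬝ᵥ ψ (π w) t‖ ^ 2)
      (fun c _ => sq_nonneg _) (mem_univ s)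
  obtain ⟨R, hR, hreach⟩ := exists_cycle_transversal π hπ
  have hrank : ∀ w ∈ Rᶜ, Nat.find (hreach (π w)) < Nat.find (hreach w) := fun w hw => by
    have hspec := Nat.find_spec (hreach w)
    rcases hk : Nat.find (hreach w) with _ | k
    · rw [hk] at hspec
      exact absurd hspec (mem_compl.mp hw)
    · rw [hk, pow_succ, Equiv.Perm.mul_apply] at hspec
      exact Nat.lt_succ_of_le (Nat.find_min' _ hspec)
  have hsum := card_pow_mul_sum_prod_of_rank
    (fun w s t => ‖star (ψ w s) ⬝ᵥ ψ (π w) t‖ ^ 2) hcol π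
    (fun w => Nat.find (hreach w)) Rᶜ hrank
  rw [Fintype.card_fin] at hsum
  have hd0 : (0 : ℝ) < d := by exact_mod_cast hd
  have hd1 : (1 : ℝ) ≤ d := by exact_mod_cast hd
  have hmono : ∑ x : W → Fin d, ∏ w : W, ‖star (ψ w (x w)) ⬝ᵥ ψ (π w) (x (π w))‖ ^ 2 ≤
      ∑ x : W → Fin d, ∏ w ∈ Rᶜ, ‖star (ψ w (x w)) ⬝ᵥ ψ (π w) (x (π w))‖ ^ 2 := by
    refine Finset.sum_le_sum fun x _ => ?_
    rw [← Finset.prod_mul_prod_compl R]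
    exact mul_le_of_le_one_left (Finset.prod_nonneg fun w _ => sq_nonneg _)
      (Finset.prod_le_one (fun w _ => sq_nonneg _) fun w _ => hle _ _ _)
  have hcard : (Fintype.card W : ℝ) ≤ 2 * #Rᶜ := by
    have := Finset.card_add_card_compl R
    exact_mod_cast (by omega : Fintype.card W ≤ 2 * #Rᶜ)
  calc _ ≤ (1 / (d : ℝ) ^ Fintype.card W) *
        ∑ x : W → Fin d, ∏ w ∈ Rᶜ, ‖star (ψ w (x w)) ⬝ᵥ ψ (π w) (x (π w))‖ ^ 2 := by
        gcongr
    _ = (d : ℝ) ^ (-(#Rᶜ : ℝ)) := by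
        rw [Real.rpow_neg hd0.le, Real.rpow_natCast, ← hsum, one_div, mul_inv, mul_assoc,
          inv_mul_cancel₀, mul_one]
        intro h0
        rw [h0, mul_zero] at hsum
        exact (pow_pos hd0 _).ne hsum
    _ ≤ _ := Real.rpow_le_rpow_of_exponent_le hd1 (by linarith)
end

section
/- Approximate k-designs have small k-th moments of the centered single-copy likelihood overlap: let n, k ≥ 1 with k² ≤ 2^{n−1}, d = 2^n, 0 ≤ ε ≤ 1/2, and let ν be a finitely supported probability distribution on unit vectors ψ ∈ ℂ^d such that for every 1 ≤ j ≤ k: (1−ε)·E_ν[(ψψ^*)^{⊗j}] ≤ Π_j / C(d+j−1, j) ≤ (1+ε)·E_ν[(ψψ^*)^{⊗j}] in the Löwner order, where Π_j = (1/j!)·Σ_{π∈S_j} P_π is the projector onto the symmetric subspace of (ℂ^d)^{⊗j}. Then there is an absolute constant C such that for every orthonormal basis (φ_s)_{s∈[d]} of ℂ^d: E_{ψ,ψ'∼ν i.i.d.}[ ( d·Σ_{s=1}^d |⟨φ_s, ψ⟩|²·|⟨φ_s, ψ'⟩|² − 1 )^k ] ≤ C·2^k·( k²·k^k·2^{−n}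 + ε ). -/
open Matrix BigOperators Finset
open scoped ComplexOrder

section ProductVectors

lemma star_prod_dotProduct {d u : ℕ} (a b : Fin u → Fin d → ℂ) :
    star (fun g : Fin u → Fin d => ∏ i, a i (g i)) ⬝ᵥ (fun g => ∏ i, b i (g i))
      = ∏ i, star (a i) ⬝ᵥ b i := by
  simp only [dotProduct, Pi.star_apply, star_prod, Fintype.prod_sum, Finset.prod_mul_distrib]

lemma tpow_projVec {d : ℕ} (u : ℕ) (ψ : Fin d → ℂ) :
    tpow u (projVec ψ) = Matrix.vecMulVec (fun g : Fin u → Fin d => ∏ i, ψ (g i))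
      (star fun g => ∏ i, ψ (g i)) := by
  ext f g
  simp [tpow, projVec, Matrix.vecMulVec_apply, Finset.prod_mul_distrib, star_prod]

lemma quadForm_tpow_projVec {d u : ℕ} (φ : Fin d → Fin d → ℂ) (ψ : Fin d → ℂ)
    (f : Fin u → Fin d) :
    star (fun g : Fin u → Fin d => ∏ i, φ (f i) (g i)) ⬝ᵥ
        (tpow u (projVec ψ) *ᵥ fun g => ∏ i, φ (f i) (g i))
      = ((∏ i, ‖star (φ (f i)) ⬝ᵥ ψ‖ ^ 2 : ℝ) : ℂ) := by
  rw [tpow_projVec, Matrix.vecMulVec_mulVec, op_smul_eq_smul, dotProduct_smul, smul_eq_mul,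
    star_prod_dotProduct (fun _ => ψ) (fun i => φ (f i)),
    star_prod_dotProduct (fun i => φ (f i)) (fun _ => ψ), ← Finset.prod_mul_distrib]
  push_cast
  refine Finset.prod_congr rfl fun i _ => ?_
  rw [← Complex.conj_mul', starRingEnd_apply, Matrix.star_dotProduct]

lemma permMat_mulVec_prod {d u : ℕ} (φ : Fin d → Fin d → ℂ) (f : Fin u → Fin d)
    (π : Equiv.Perm (Fin u)) :
    (permMat π *ᵥ fun g : Fin u → Fin d => ∏ i, φ (f i) (g i))
      = fun g => ∏ i, φ (f (π⁻¹ i)) (g i) := by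
  ext g
  have h : ∀ x : Fin u → Fin d, (∀ i, g (π i) = x i) ↔ x = g ∘ π := fun x =>
    ⟨fun h => funext fun i => (h i).symm, fun h i => by simp [h]⟩
  simp only [Matrix.mulVec, dotProduct, permMat, Matrix.of_apply, h, ite_mul, one_mul, zero_mul,
    Finset.sum_ite_eq', Finset.mem_univ, if_true, Function.comp_apply]
  exact Fintype.prod_equiv π _ _ fun i => by simp

/-- The number of permutations of the positions that leave the word `f` unchanged. -/
def stabCard {d u : ℕ} (f : Fin u → Fin d) : ℕ :=
  Fintype.card {π : Equiv.Perm (Fin u) // f ∘ π = f}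

lemma quadForm_sum_permMat {d u : ℕ} {φ : Fin d → Fin d → ℂ} (hφ : IsONB φ)
    (f : Fin u → Fin d) :
    star (fun g : Fin u → Fin d => ∏ i, φ (f i) (g i)) ⬝ᵥ
        ((∑ π : Equiv.Perm (Fin u), permMat π) *ᵥ fun g => ∏ i, φ (f i) (g i))
      = (stabCard f : ℂ) := by
  rw [Matrix.sum_mulVec, dotProduct_sum, stabCard, Fintype.card_subtype, Finset.card_filter,
    Nat.cast_sum, ← Equiv.sum_comp (Equiv.inv (Equiv.Perm (Fin u)))]
  refine Finset.sum_congr rfl fun π _ => ?_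
  rw [permMat_mulVec_prod, star_prod_dotProduct (fun i => φ (f i))]
  simp only [hφ _ _, Equiv.inv_apply, inv_inv, Finset.prod_ite_zero, Finset.prod_const_one,
    Finset.mem_univ, true_implies, Nat.cast_ite, Nat.cast_one, Nat.cast_zero]
  refine if_congr ⟨fun h => funext fun i => (h i).symm, fun h i => (congrFun h i).symm⟩ rfl rfl

end ProductVectors

section Stabilizers

/-- The number of occurrences of the letter `a` in the word `f`. -/
def letterCount {d u : ℕ} (f : Fin u → Fin d) (a : Fin d) : ℕ := #{i | f i = a}

lemma sum_letterCount {d u : ℕ} (f : Fin u → Fin d) : ∑ a, letterCount f a = u := by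
  simpa [letterCount] using
    (Finset.card_eq_sum_card_fiberwise (f := f) (s := univ) (t := univ) (by simp)).symm

lemma stabCard_eq_prod {d u : ℕ} (f : Fin u → Fin d) :
    stabCard f = ∏ a, (letterCount f a).factorial := by
  unfold stabCard letterCount
  convert DomMulAct.stabilizer_card f using 3 with a
  rw [Fintype.card_subtype]

lemma stabCard_cons {d u : ℕ} (x : Fin d) (f : Fin u → Fin d) :
    stabCard (Fin.cons x f : Fin (u + 1) → Fin d) = (letterCount f x + 1) * stabCard f := by
  have h : ∀ a, letterCount (Fin.cons x f : Fin (u + 1) → Fin d) a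
      = if x = a then letterCount f a + 1 else letterCount f a := fun a => by
    simp only [letterCount, Fin.card_filter_univ_succ, Fin.cons_zero, Fin.cons_succ]
  rw [stabCard_eq_prod, stabCard_eq_prod, ← Finset.mul_prod_erase _ _ (Finset.mem_univ x),
    ← Finset.mul_prod_erase univ (fun a => (letterCount f a).factorial) (Finset.mem_univ x),
    h, if_pos rfl, Nat.factorial_succ, mul_assoc]
  congr 2
  refine Finset.prod_congr rfl fun a ha => ?_
  rw [h, if_neg (Finset.ne_of_mem_erase ha).symm]

lemma sum_stabCard_sq_succ (d u : ℕ) :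
    ∑ f : Fin (u + 1) → Fin d, (stabCard f : ℝ) ^ 2
      = ∑ f : Fin u → Fin d, (stabCard f : ℝ) ^ 2 * ∑ x, ((letterCount f x : ℝ) + 1) ^ 2 := by
  rw [← Equiv.sum_comp (Fin.consEquiv fun _ => Fin d), Fintype.sum_prod_type_right]
  refine Finset.sum_congr rfl fun f _ => ?_
  rw [Finset.mul_sum]
  refine Finset.sum_congr rfl fun x _ => ?_
  change (stabCard (Fin.cons x f : Fin (u + 1) → Fin d) : ℝ) ^ 2 = _
  rw [stabCard_cons]
  push_cast
  ring

lemma sum_cast_letterCount {d u : ℕ} (f : Fin u → Fin d) : ∑ a, (letterCount f a : ℝ) = u := by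
  exact_mod_cast sum_letterCount f

lemma add_sq_le_sum_letterCount {d u : ℕ} (f : Fin u → Fin d) :
    ((d : ℝ) + u) ^ 2 ≤ d * ∑ x, ((letterCount f x : ℝ) + 1) ^ 2 := by
  have h := sq_sum_le_card_mul_sum_sq (s := univ) (f := fun x => (letterCount f x : ℝ) + 1)
  simpa [Finset.sum_add_distrib, sum_cast_letterCount, add_comm] using h

lemma sum_letterCount_add_one_sq_le {d u : ℕ} (f : Fin u → Fin d) :
    ∑ x, ((letterCount f x : ℝ) + 1) ^ 2 ≤ (d : ℝ) + 2 * u + (u : ℝ) ^ 2 := by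
  have h : ∑ x, (letterCount f x : ℝ) ^ 2 ≤ (∑ x, (letterCount f x : ℝ)) ^ 2 :=
    Finset.sum_sq_le_sq_sum_of_nonneg fun _ _ => Nat.cast_nonneg _
  rw [sum_cast_letterCount] at h
  simp only [add_sq, Finset.sum_add_distrib, mul_one, ← Finset.mul_sum, one_pow,
    sum_cast_letterCount, Finset.sum_const, Finset.card_univ, Fintype.card_fin, nsmul_eq_mul]
  linarith

/-- The `u`-th moment of the overlap `d * ∑ s, |⟨φ_s, ψ⟩|² |⟨φ_s, ψ'⟩|²` of two independent Haar
random unit vectors `ψ, ψ'` of `ℂ^d`, as a sum over the outcomes of `u` measurements. -/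
noncomputable def haarMoment (d u : ℕ) : ℝ :=
  d ^ u * ∑ f : Fin u → Fin d, ((stabCard f : ℝ) / d.ascFactorial u) ^ 2

lemma haarMoment_eq (d u : ℕ) : haarMoment d u =
    d ^ u * (∑ f : Fin u → Fin d, (stabCard f : ℝ) ^ 2) / (d.ascFactorial u : ℝ) ^ 2 := by
  simp only [haarMoment, div_pow, ← Finset.sum_div, mul_div_assoc]

lemma haarMoment_zero (d : ℕ) : haarMoment d 0 = 1 := by
  simp [haarMoment, stabCard_eq_prod, letterCount]

lemma haarMoment_le_succ {d : ℕ} (hd : 0 < d) (u : ℕ) :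
    haarMoment d u ≤ haarMoment d (u + 1) := by
  have hd' : (0 : ℝ) < d := by exact_mod_cast hd
  have ha : (0 : ℝ) < d.ascFactorial u := by
    obtain ⟨m, rfl⟩ := Nat.exists_eq_succ_of_ne_zero hd.ne'
    exact_mod_cast Nat.ascFactorial_pos m u
  rw [haarMoment_eq, haarMoment_eq, Nat.ascFactorial_succ, div_le_div_iff₀ (by positivity)
    (by push_cast; positivity), sum_stabCard_sq_succ]
  have h : (∑ f : Fin u → Fin d, (stabCard f : ℝ) ^ 2) * ((d : ℝ) + u) ^ 2
      ≤ d * ∑ f : Fin u → Fin d, (stabCard f : ℝ) ^ 2 * ∑ x, ((letterCount f x : ℝ) + 1) ^ 2 := by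
    rw [Finset.sum_mul, Finset.mul_sum]
    refine Finset.sum_le_sum fun f _ => ?_
    rw [mul_left_comm]
    exact mul_le_mul_of_nonneg_left (add_sq_le_sum_letterCount f) (sq_nonneg _)
  have h' := mul_le_mul_of_nonneg_left h
    (by positivity : (0 : ℝ) ≤ d ^ u * (d.ascFactorial u : ℝ) ^ 2)
  push_cast
  convert h' using 1 <;> ring

lemma haarMoment_succ_le {d : ℕ} (hd : 0 < d) (u : ℕ) :
    haarMoment d (u + 1) ≤ haarMoment d u * (1 + u ^ 2 / d) := by
  have hd' : (0 : ℝ) < d := by exact_mod_cast hd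
  have ha : (0 : ℝ) < d.ascFactorial u := by
    obtain ⟨m, rfl⟩ := Nat.exists_eq_succ_of_ne_zero hd.ne'
    exact_mod_cast Nat.ascFactorial_pos m u
  have h : ∑ f : Fin u → Fin d, (stabCard f : ℝ) ^ 2 * ∑ x, ((letterCount f x : ℝ) + 1) ^ 2
      ≤ (∑ f : Fin u → Fin d, (stabCard f : ℝ) ^ 2) * (d + 2 * u + u ^ 2) := by
    rw [Finset.sum_mul]
    exact Finset.sum_le_sum fun f _ =>
      mul_le_mul_of_nonneg_left (sum_letterCount_add_one_sq_le f) (sq_nonneg _)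
  have hpoly : (d : ℝ) * (d + 2 * u + u ^ 2) ≤ (d + u) ^ 2 * (1 + u ^ 2 / d) := by
    have : ((d : ℝ) + u) ^ 2 * (1 + u ^ 2 / d)
        = d * (d + 2 * u + u ^ 2) + (u ^ 2 + 2 * u ^ 3 + u ^ 4 / d) := by
      field_simp; ring
    rw [this]
    have : (0 : ℝ) ≤ u ^ 2 + 2 * u ^ 3 + u ^ 4 / d := by positivity
    linarith
  rw [haarMoment_eq, haarMoment_eq, Nat.ascFactorial_succ, sum_stabCard_sq_succ,
    div_mul_eq_mul_div, div_le_div_iff₀ (by push_cast; positivity) (by positivity)]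
  set F := ∑ f : Fin u → Fin d, (stabCard f : ℝ) ^ 2 with hF
  have hF0 : 0 ≤ F := by positivity
  have hstep := (mul_le_mul_of_nonneg_left h hd'.le).trans
    (by simpa [mul_left_comm] using mul_le_mul_of_nonneg_left hpoly hF0)
  have h' := mul_le_mul_of_nonneg_left hstep
    (by positivity : (0 : ℝ) ≤ d ^ u * (d.ascFactorial u : ℝ) ^ 2)
  push_cast
  convert h' using 1 <;> ring

lemma one_le_haarMoment {d : ℕ} (hd : 0 < d) (u : ℕ) : 1 ≤ haarMoment d u :=
  haarMoment_zero d ▸ monotone_nat_of_le_succ (haarMoment_le_succ hd) (Nat.zero_le u)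

lemma haarMoment_le {d k : ℕ} (hd : 0 < d) (hk : k ^ 2 ≤ d) {u : ℕ} (hu : u ≤ k) :
    haarMoment d u ≤ 1 + (2 ^ u - 1) * (k ^ 2 / d) := by
  have hd' : (0 : ℝ) < d := by exact_mod_cast hd
  have hk' : (k : ℝ) ^ 2 / d ≤ 1 := (div_le_one hd').2 (by exact_mod_cast hk)
  have h0 : (0 : ℝ) ≤ (k : ℝ) ^ 2 / d := by positivity
  induction u with
  | zero => simp [haarMoment_zero]
  | succ u ih =>
    specialize ih (by omega)
    have hp : (1 : ℝ) ≤ 2 ^ u := one_le_pow₀ (by norm_num)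
    have huk : (u : ℝ) ^ 2 / d ≤ (k : ℝ) ^ 2 / d := by
      have : (u : ℝ) ≤ k := by exact_mod_cast (by omega : u ≤ k)
      gcongr
    calc haarMoment d (u + 1) ≤ haarMoment d u * (1 + u ^ 2 / d) := haarMoment_succ_le hd u
      _ ≤ (1 + (2 ^ u - 1) * (k ^ 2 / d)) * (1 + k ^ 2 / d) :=
        mul_le_mul ih (by linarith) (by positivity)
          (by nlinarith [mul_nonneg (sub_nonneg.2 hp) h0])
      _ ≤ 1 + (2 ^ (u + 1) - 1) * (k ^ 2 / d) := by
        rw [pow_succ (2 : ℝ)]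
        nlinarith [mul_nonneg (mul_nonneg (sub_nonneg.2 hp) h0) (sub_nonneg.2 hk')]

end Stabilizers

section DesignMoments

variable {d : ℕ} {J : Type} [Fintype J]

/-- The probability of the outcomes `f` when `u` copies of a random state, equal to `ψ j` with
probability `w j`, are each measured in the basis `φ`. -/
noncomputable def outcomeProb (w : J → ℝ) (ψ : J → Fin d → ℂ) (φ : Fin d → Fin d → ℂ) {u : ℕ}
    (f : Fin u → Fin d) : ℝ :=
  ∑ j, w j * ∏ i, ‖star (φ (f i)) ⬝ᵥ ψ j‖ ^ 2

/-- The expectation of the `u`-th power of the overlap of two independent states. -/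
lemma sum_overlap_pow (w : J → ℝ) (ψ : J → Fin d → ℂ) (φ : Fin d → Fin d → ℂ) (u : ℕ) :
    ∑ j, ∑ j', w j * w j' * ((d : ℝ) * ∑ s,
        ‖star (φ s) ⬝ᵥ ψ j‖ ^ 2 * ‖star (φ s) ⬝ᵥ ψ j'‖ ^ 2) ^ u
      = d ^ u * ∑ f : Fin u → Fin d, outcomeProb w ψ φ f ^ 2 := by
  simp_rw [mul_pow (d : ℝ)]
  simp only [Fintype.sum_pow, Finset.prod_mul_distrib, Finset.mul_sum, outcomeProb,
    pow_two (∑ j, w j * _), Finset.sum_mul]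
  rw [Finset.sum_comm]
  simp_rw [Finset.sum_comm (s := (univ : Finset J)) (t := (univ : Finset (Fin u → Fin d)))]
  refine Finset.sum_congr rfl fun f _ => Finset.sum_congr rfl fun j _ =>
    Finset.sum_congr rfl fun j' _ => ?_
  ring

lemma outcomeProb_bounds (w : J → ℝ) (ψ : J → Fin d → ℂ) {φ : Fin d → Fin d → ℂ}
    (hφ : IsONB φ) (ε : ℝ) {u : ℕ}
    (h₁ : (((Nat.choose (d + u - 1) u : ℂ))⁻¹ •
            ((u.factorial : ℂ)⁻¹ • ∑ π : Equiv.Perm (Fin u), permMat π)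
          - ((1 - ε : ℝ) : ℂ) • ∑ j, (w j : ℂ) • tpow u (projVec (ψ j))).PosSemidef)
    (h₂ : (((1 + ε : ℝ) : ℂ) • (∑ j, (w j : ℂ) • tpow u (projVec (ψ j)))
          - ((Nat.choose (d + u - 1) u : ℂ))⁻¹ •
              ((u.factorial : ℂ)⁻¹ • ∑ π : Equiv.Perm (Fin u), permMat π)).PosSemidef)
    (f : Fin u → Fin d) :
    (1 - ε) * outcomeProb w ψ φ f ≤ stabCard f / d.ascFactorial u ∧
      (stabCard f : ℝ) / d.ascFactorial u ≤ (1 + ε) * outcomeProb w ψ φ f := by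
  have e₁ := h₁.dotProduct_mulVec_nonneg (fun g => ∏ i, φ (f i) (g i))
  have e₂ := h₂.dotProduct_mulVec_nonneg (fun g => ∏ i, φ (f i) (g i))
  simp only [Matrix.sub_mulVec, dotProduct_sub, Matrix.smul_mulVec, dotProduct_smul,
    quadForm_sum_permMat hφ f, Matrix.sum_mulVec _ (fun j => (w j : ℂ) • tpow u (projVec (ψ j))),
    dotProduct_sum, quadForm_tpow_projVec, smul_eq_mul] at e₁ e₂
  have hs : (stabCard f : ℝ) / d.ascFactorial u
      = ((d + u - 1).choose u : ℝ)⁻¹ * ((u.factorial : ℝ)⁻¹ * stabCard f) := by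
    rw [Nat.ascFactorial_eq_factorial_mul_choose']
    push_cast
    rw [div_eq_mul_inv, mul_inv]
    ring
  rw [hs, outcomeProb]
  constructor
  · rw [← sub_nonneg, ← Complex.zero_le_real]
    push_cast at e₁ ⊢
    exact e₁
  · rw [← sub_nonneg, ← Complex.zero_le_real]
    push_cast at e₂ ⊢
    exact e₂

lemma abs_sq_sub_sq_le {ε m h : ℝ} (hε : 0 ≤ ε) (hε' : ε ≤ 1 / 2) (hm : 0 ≤ m)
    (h₁ : (1 - ε) * m ≤ h) (h₂ : h ≤ (1 + ε) * m) : |m ^ 2 - h ^ 2| ≤ 8 * ε * h ^ 2 := by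
  have hh : 0 ≤ h := le_trans (by nlinarith) h₁
  have hm2 : m ≤ 2 * h := by nlinarith
  rw [abs_le]
  constructor
  · nlinarith [mul_nonneg hε hm, mul_nonneg hε hh, mul_nonneg hh (sub_nonneg.2 h₂)]
  · nlinarith [mul_nonneg hε hm, mul_nonneg hε hh, mul_nonneg hh (sub_nonneg.2 h₁)]

end DesignMoments

lemma sum_range_choose_mul_neg_one_pow {k : ℕ} (hk : k ≠ 0) :
    ∑ u ∈ range (k + 1), (-1 : ℝ) ^ (k - u) * (k.choose u : ℝ) = 0 := by
  have h := add_pow (1 : ℝ) (-1) k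
  simpa [hk] using h.symm

lemma two_pow_le_two_mul_pow_self {k : ℕ} (hk : 1 ≤ k) : (2 : ℝ) ^ k ≤ 2 * (k : ℝ) ^ k := by
  rcases hk.eq_or_lt with rfl | hk
  · norm_num
  · have h : (2 : ℝ) ≤ k := by exact_mod_cast hk
    have := pow_le_pow_left₀ (by norm_num) h k
    have : (0 : ℝ) ≤ (k : ℝ) ^ k := by positivity
    linarith

lemma sum_overlap_sub_one_pow {d : ℕ} {J : Type} [Fintype J] (w : J → ℝ) (ψ : J → Fin d → ℂ)
    (φ : Fin d → Fin d → ℂ) (k : ℕ) :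
    ∑ j, ∑ j', w j * w j' * ((d : ℝ) * (∑ s,
        ‖star (φ s) ⬝ᵥ ψ j‖ ^ 2 * ‖star (φ s) ⬝ᵥ ψ j'‖ ^ 2) - 1) ^ k
      = ∑ u ∈ range (k + 1), (-1) ^ (k - u) * (k.choose u : ℝ) *
          (d ^ u * ∑ f : Fin u → Fin d, outcomeProb w ψ φ f ^ 2) := by
  simp_rw [← sum_overlap_pow, sub_eq_add_neg _ (1 : ℝ), add_pow _ (-1 : ℝ),
    Finset.mul_sum univ _ (_ * _), Finset.mul_sum (range (k + 1)),
    Finset.sum_comm (s := univ) (t := range (k + 1))]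
  refine Finset.sum_congr rfl fun u _ => Finset.sum_congr rfl fun j _ =>
    Finset.sum_congr rfl fun j' _ => ?_
  ring

/-- approximate `k`-designs have small `k`-th moments of the centered
single-copy likelihood overlap. -/
theorem approx_design_small_overlap_moments :
    ∃ C : ℝ, 0 < C ∧
      ∀ (n k : ℕ), 1 ≤ n → 1 ≤ k → k ^ 2 ≤ 2 ^ (n - 1) →
      ∀ ε : ℝ, 0 ≤ ε → ε ≤ 1 / 2 →
      ∀ (J : Type) [Fintype J] (w : J → ℝ), (∀ j, 0 ≤ w j) → (∑ j, w j) = 1 →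
      ∀ ψ : J → Fin (2 ^ n) → ℂ, (∀ j, star (ψ j) ⬝ᵥ ψ j = 1) →
      (∀ u : ℕ, 1 ≤ u → u ≤ k →
        (((Nat.choose (2 ^ n + u - 1) u : ℂ))⁻¹ •
            ((u.factorial : ℂ)⁻¹ • ∑ π : Equiv.Perm (Fin u), permMat π)
          - ((1 - ε : ℝ) : ℂ) • ∑ j, (w j : ℂ) • tpow u (projVec (ψ j))).PosSemidef
        ∧ (((1 + ε : ℝ) : ℂ) • (∑ j, (w j : ℂ) • tpow u (projVec (ψ j)))
          - ((Nat.choose (2 ^ n + u - 1) u : ℂ))⁻¹ •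
              ((u.factorial : ℂ)⁻¹ • ∑ π : Equiv.Perm (Fin u), permMat π)).PosSemidef) →
      ∀ φ : Fin (2 ^ n) → Fin (2 ^ n) → ℂ, IsONB φ →
        ∑ j, ∑ j', w j * w j' *
            ((2 ^ n : ℝ) * (∑ s : Fin (2 ^ n),
                ‖star (φ s) ⬝ᵥ ψ j‖ ^ 2 * ‖star (φ s) ⬝ᵥ ψ j'‖ ^ 2) - 1) ^ k
          ≤ C * 2 ^ k * ((k : ℝ) ^ 2 * (k : ℝ) ^ k / 2 ^ n + ε) := by
  refine ⟨10, by norm_num, ?_⟩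
  intro n k hn hk hkn ε hε hε' J _ w hw hw1 ψ hψ hdes φ hφ
  have hcast : (2 : ℝ) ^ n = ((2 ^ n : ℕ) : ℝ) := by push_cast; rfl
  have hkd : k ^ 2 ≤ 2 ^ n := hkn.trans (Nat.pow_le_pow_right (by norm_num) (by omega))
  have hd0 : 0 < 2 ^ n := by positivity
  rw [hcast]
  clear hcast hkn
  generalize 2 ^ n = d at *
  set B : ℝ := 2 * ((k : ℝ) ^ 2 * (k : ℝ) ^ k / d) with hB
  have hB0 : 0 ≤ B := by positivity
  have hM : ∀ u ≤ k, haarMoment d u ≤ 1 + B := fun u hu => by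
    have h2 : (2 : ℝ) ^ u ≤ 2 * (k : ℝ) ^ k :=
      (pow_le_pow_right₀ (by norm_num) hu).trans (two_pow_le_two_mul_pow_self hk)
    have h3 : (0 : ℝ) ≤ (k : ℝ) ^ 2 / d := by positivity
    calc haarMoment d u ≤ 1 + (2 ^ u - 1) * (k ^ 2 / d) := haarMoment_le hd0 hkd hu
      _ ≤ 1 + (2 * (k : ℝ) ^ k) * (k ^ 2 / d) := by gcongr; linarith
      _ = 1 + B := by rw [hB]; ring
  have hclose : ∀ u ≤ k, |d ^ u * ∑ f : Fin u → Fin d, outcomeProb w ψ φ f ^ 2 - haarMoment d u|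
      ≤ 8 * ε * haarMoment d u := fun u hu => by
    rcases Nat.eq_zero_or_pos u with rfl | hu0
    · simp [outcomeProb, haarMoment_zero, hw1, hε]
    · rw [haarMoment, ← mul_sub, ← Finset.sum_sub_distrib, abs_mul,
        abs_of_nonneg (by positivity : (0 : ℝ) ≤ (d : ℝ) ^ u), mul_left_comm, Finset.mul_sum]
      refine mul_le_mul_of_nonneg_left ((Finset.abs_sum_le_sum_abs _ _).trans
        (Finset.sum_le_sum fun f _ => ?_)) (by positivity)
      obtain ⟨h₁, h₂⟩ := outcomeProb_bounds w ψ hφ ε (hdes u hu0 hu).1 (hdes u hu0 hu).2 f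
      exact abs_sq_sub_sq_le hε hε'
        (Finset.sum_nonneg fun j _ => mul_nonneg (hw j) (by positivity)) h₁ h₂
  have hone : ∀ u ≤ k, |d ^ u * ∑ f : Fin u → Fin d, outcomeProb w ψ φ f ^ 2 - 1|
      ≤ 8 * ε + 5 * B := fun u hu => by
    have h₁ := one_le_haarMoment hd0 u
    have h₂ := hM u hu
    have h₃ := abs_le.1 (hclose u hu)
    have h₄ : ε * haarMoment d u ≤ ε * (1 + B) := mul_le_mul_of_nonneg_left h₂ hε
    have h₅ : ε * B ≤ 1 / 2 * B := mul_le_mul_of_nonneg_right hε' hB0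
    rw [abs_le]
    constructor <;> linarith
  rw [sum_overlap_sub_one_pow]
  calc _ = ∑ u ∈ range (k + 1), (-1) ^ (k - u) * (k.choose u : ℝ) *
          (d ^ u * ∑ f : Fin u → Fin d, outcomeProb w ψ φ f ^ 2 - 1) := by
        simp only [mul_sub, mul_one, Finset.sum_sub_distrib,
          sum_range_choose_mul_neg_one_pow (by omega : k ≠ 0), sub_zero]
    _ ≤ ∑ u ∈ range (k + 1), (k.choose u : ℝ) * (8 * ε + 5 * B) := by
        refine Finset.sum_le_sum fun u hu => (le_abs_self _).trans ?_
        rw [abs_mul, abs_mul, abs_pow, abs_neg, abs_one, one_pow, one_mul, Nat.abs_cast]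
        exact mul_le_mul_of_nonneg_left (hone u (by simpa [Nat.lt_succ_iff] using hu))
          (Nat.cast_nonneg _)
    _ = 2 ^ k * (8 * ε + 5 * B) := by
        rw [← Finset.sum_mul]
        congr 1
        exact_mod_cast Nat.sum_range_choose k
    _ ≤ 10 * 2 ^ k * ((k : ℝ) ^ 2 * (k : ℝ) ^ k / d + ε) := by
        rw [mul_comm (10 : ℝ), mul_assoc]
        refine mul_le_mul_of_nonneg_left ?_ (by positivity)
        rw [hB]
        linarith
end

section
/- Factorization identity for the copy-wise truncated likelihood ratio: let n, m ≥ 1, D ≥ 0, k ≥ 1, let μ be a finitely supported probability distribution over n-qubit density matrices, and for each i ∈ [m] let (φ^i_s)_{s ∈ {0,1}^n} be an orthonormal basis of ℂ^{2^n}. For a density matrix ρ let D̄^{(i)}_ρ(s) = 2^n·⟨φ^i_s, ρ φ^i_s⟩, let D̄_{ρ,m}(s_1,…,s_m) = ∏_{i=1}^m D̄^{(i)}_ρ(s_i), and write f^{≤D,k} for the orthogonal projection, in L² of the uniform distribution on ({0,1}^n)^m, onto the span of the functions ∏_{i=1}^m χ_{S_i}(s_i) with every |S_i| ≤ D and at most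 k of the S_i nonempty. Then ‖ E_{ρ∼μ}[ D̄_{ρ,m}^{≤D,k} ] − 1 ‖² = Σ_{T ⊆ [m], 0 < |T| ≤ k} E_{ρ,ρ'∼μ i.i.d.}[ ∏_{i∈T} ( ⟨ (D̄^{(i)}_ρ)^{≤D}, (D̄^{(i)}_{ρ'})^{≤D} ⟩ − 1 ) ], where for functions on {0,1}^n, g^{≤D} is the projection onto span{χ_S : |S| ≤ D}, ⟨f,g⟩ = 2^{−n} Σ_s f(s)g(s), and ‖·‖ is the L² norm with respect to the uniform distribution on ({0,1}^n)^m. -/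
open Matrix BigOperators Finset
open scoped ComplexOrder

/-- The Fourier character `χ_S(s) = (−1)^{Σ_{j∈S} s_j}` on `{0,1}^n`. -/
def chiB {n : ℕ} (S : Finset (Fin n)) (s : Fin n → Fin 2) : ℝ :=
  (-1 : ℝ) ^ (∑ j ∈ S, (s j).val)

/-- The `L²` inner product `⟨f,g⟩ = 2^{−n} Σ_s f(s)g(s)` with respect to the uniform
distribution on `{0,1}^n`. -/
noncomputable def innerB (n : ℕ) (f g : (Fin n → Fin 2) → ℝ) : ℝ :=
  ((2 : ℝ) ^ n)⁻¹ * ∑ s, f s * g s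

/-- The orthogonal projection of `g : {0,1}^n → ℝ` onto `span{χ_S : |S| ≤ D}`. -/
noncomputable def truncD (n D : ℕ) (g : (Fin n → Fin 2) → ℝ) :
    (Fin n → Fin 2) → ℝ :=
  fun s => ∑ S : Finset (Fin n),
    if S.card ≤ D then innerB n g (chiB S) * chiB S s else 0

/-- The single-copy likelihood ratio `D̄_ρ(s) = 2^n·⟨φ_s, ρ φ_s⟩` for measurement of `ρ`
in the orthonormal basis `φ`, against the maximally mixed state. -/
noncomputable def Dbar (n : ℕ) (φ : (Fin n → Fin 2) → (Fin n → Fin 2) → ℂ)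
    (ρ : Matrix (Fin n → Fin 2) (Fin n → Fin 2) ℂ) : (Fin n → Fin 2) → ℝ :=
  fun s => (2 : ℝ) ^ n * (star (φ s) ⬝ᵥ (ρ *ᵥ φ s)).re

/-- The `m`-copy product character `∏_i χ_{S_i}(s_i)`. -/
def chiM {n m : ℕ} (S : Fin m → Finset (Fin n)) (s : Fin m → Fin n → Fin 2) : ℝ :=
  ∏ i, chiB (S i) (s i)

/-- The `L²` inner product with respect to the uniform distribution on `({0,1}^n)^m`. -/
noncomputable def innerM (n m : ℕ) (F G : (Fin m → Fin n → Fin 2) → ℝ) : ℝ :=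
  ((2 : ℝ) ^ (m * n))⁻¹ * ∑ s, F s * G s

/-- The orthogonal projection of `F` onto the span of products `∏_i χ_{S_i}(s_i)` with
each `|S_i| ≤ D` and at most `k` of the `S_i` nonempty (sample-wise degree `(D,k)`). -/
noncomputable def truncDk (n m D k : ℕ) (F : (Fin m → Fin n → Fin 2) → ℝ) :
    (Fin m → Fin n → Fin 2) → ℝ :=
  fun s => ∑ S : Fin m → Finset (Fin n),
    if (∀ i, (S i).card ≤ D) ∧ (Finset.univ.filter fun i => S i ≠ ∅).card ≤ k then
      innerM n m F (chiM S) * chiM S s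
    else 0

/-- The `m`-copy likelihood ratio `D̄_{ρ,m}(s) = ∏_i D̄^{(i)}_ρ(s_i)`. -/
noncomputable def DbarM (n m : ℕ)
    (φ : Fin m → (Fin n → Fin 2) → (Fin n → Fin 2) → ℂ)
    (ρ : Matrix (Fin n → Fin 2) (Fin n → Fin 2) ℂ) : (Fin m → Fin n → Fin 2) → ℝ :=
  fun s => ∏ i, Dbar n (φ i) ρ (s i)

theorem chiB_eq_prod {n : ℕ} (S : Finset (Fin n)) (s : Fin n → Fin 2) :
    chiB S s = ∏ j, if j ∈ S then (-1 : ℝ) ^ (s j).val else 1 := by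
  rw [chiB, ← Finset.prod_pow_eq_pow_sum, Finset.prod_ite_mem, Finset.univ_inter]

theorem innerB_chiB {n : ℕ} (S T : Finset (Fin n)) :
    innerB n (chiB S) (chiB T) = if S = T then 1 else 0 := by
  have hfac : ∑ s, chiB S s * chiB T s = ∏ j, if (j ∈ S ↔ j ∈ T) then (2 : ℝ) else 0 := by
    simp only [chiB_eq_prod, ← Finset.prod_mul_distrib]
    rw [← Fintype.prod_sum fun (j : Fin n) (b : Fin 2) =>
      (if j ∈ S then (-1 : ℝ) ^ b.val else 1) * (if j ∈ T then (-1 : ℝ) ^ b.val else 1)]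
    refine Finset.prod_congr rfl fun j _ => ?_
    by_cases hS : j ∈ S <;> by_cases hT : j ∈ T <;> (simp [hS, hT]; try norm_num)
  rw [innerB, hfac]
  split_ifs with h
  · subst h
    simp
  · obtain ⟨j, hj⟩ : ∃ j, ¬(j ∈ S ↔ j ∈ T) := by
      by_contra! hc
      exact h (Finset.ext hc)
    rw [Finset.prod_eq_zero (Finset.mem_univ j) (if_neg hj), mul_zero]

theorem innerM_prod {n m : ℕ} (f g : Fin m → (Fin n → Fin 2) → ℝ) :
    innerM n m (fun s => ∏ i, f i (s i)) (fun s => ∏ i, g i (s i))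
      = ∏ i, innerB n (f i) (g i) := by
  simp only [innerM, innerB, ← Finset.prod_mul_distrib]
  rw [← Fintype.prod_sum fun i t => f i t * g i t, Finset.prod_mul_distrib]
  simp [pow_mul']

theorem innerM_chiM {n m : ℕ} (S T : Fin m → Finset (Fin n)) :
    innerM n m (chiM S) (chiM T) = if S = T then 1 else 0 := by
  have h := innerM_prod (fun i => chiB (S i)) (fun i => chiB (T i))
  simp only [innerB_chiB] at h
  refine h.trans ?_
  split_ifs with hST
  · simp [hST]
  · obtain ⟨i, hi⟩ := Function.ne_iff.mp hST
    exact Finset.prod_eq_zero (Finset.mem_univ i) (if_neg hi)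

theorem mul_sum_mul_sum_of_orthonormal {κ Ω : Type*} [Fintype κ] [DecidableEq κ] [Fintype Ω]
    (c : ℝ) (e : κ → Ω → ℝ) (he : ∀ S T, c * ∑ s, e S s * e T s = if S = T then 1 else 0)
    (a b : κ → ℝ) :
    c * ∑ s, (∑ S, a S * e S s) * (∑ S, b S * e S s) = ∑ S, a S * b S := by
  calc c * ∑ s, (∑ S, a S * e S s) * (∑ S, b S * e S s)
      = c * ∑ s, ∑ S, ∑ T, a S * e S s * (b T * e T s) := by simp only [Finset.sum_mul_sum]
    _ = c * ∑ S, ∑ T, ∑ s, a S * e S s * (b T * e T s) := by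
        rw [Finset.sum_comm]
        simp only [Finset.sum_comm (s := (Finset.univ : Finset Ω))]
    _ = ∑ S, ∑ T, a S * b T * (c * ∑ s, e S s * e T s) := by
        simp only [Finset.mul_sum]
        exact Finset.sum_congr rfl fun S _ => Finset.sum_congr rfl fun T _ =>
          Finset.sum_congr rfl fun s _ => by ring
    _ = ∑ S, a S * b S := by simp [he]

theorem innerB_sum_chiB {n : ℕ} (a b : Finset (Fin n) → ℝ) :
    innerB n (fun s => ∑ S, a S * chiB S s) (fun s => ∑ S, b S * chiB S s)
      = ∑ S, a S * b S :=
  mul_sum_mul_sum_of_orthonormal _ chiB innerB_chiB a b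

theorem innerM_sum_chiM {n m : ℕ} (a b : (Fin m → Finset (Fin n)) → ℝ) :
    innerM n m (fun s => ∑ S, a S * chiM S s) (fun s => ∑ S, b S * chiM S s)
      = ∑ S, a S * b S :=
  mul_sum_mul_sum_of_orthonormal _ chiM innerM_chiM a b

theorem innerB_truncD {n D : ℕ} (f g : (Fin n → Fin 2) → ℝ) :
    innerB n (truncD n D f) (truncD n D g)
      = ∑ S : Finset (Fin n),
          if S.card ≤ D then innerB n f (chiB S) * innerB n g (chiB S) else 0 := by
  have h := innerB_sum_chiB
    (fun S => if S.card ≤ D then innerB n f (chiB S) else 0)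
    (fun S => if S.card ≤ D then innerB n g (chiB S) else 0)
  simp only [ite_mul, mul_ite, zero_mul, mul_zero] at h
  refine h.trans (Finset.sum_congr rfl fun S _ => ?_)
  split_ifs <;> rfl

theorem IsONB.sum_dotProduct_mulVec {ι : Type*} [Fintype ι] [DecidableEq ι] {φ : ι → ι → ℂ}
    (hφ : IsONB φ) (ρ : Matrix ι ι ℂ) : ∑ s, star (φ s) ⬝ᵥ (ρ *ᵥ φ s) = ρ.trace := by
  have h1 : (Matrix.of fun s x => star (φ s x)) * (Matrix.of fun x s => φ s x) = 1 := by
    ext s t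
    rw [Matrix.mul_apply, Matrix.one_apply, ← hφ s t]
    rfl
  have h2 := mul_eq_one_comm.mp h1
  have h3 : ∀ s, star (φ s) ⬝ᵥ (ρ *ᵥ φ s)
      = ((Matrix.of fun s x => star (φ s x)) * (ρ * (Matrix.of fun x s => φ s x))) s s := by
    intro s
    rfl
  simp only [h3]
  change Matrix.trace _ = _
  rw [Matrix.trace_mul_comm, Matrix.mul_assoc, h2, Matrix.mul_one]

theorem innerB_Dbar_chiB_empty {n : ℕ} {φ : (Fin n → Fin 2) → (Fin n → Fin 2) → ℂ}
    (hφ : IsONB φ) {ρ : Matrix (Fin n → Fin 2) (Fin n → Fin 2) ℂ} (hρ : ρ.trace = 1) :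
    innerB n (Dbar n φ ρ) (chiB ∅) = 1 := by
  simp only [innerB, Dbar, chiB, Finset.sum_empty, pow_zero, mul_one]
  rw [← Finset.mul_sum, inv_mul_cancel_left₀ (by positivity), ← Complex.re_sum,
    hφ.sum_dotProduct_mulVec, hρ, Complex.one_re]

/-- Expansion of a product of centred sums as a sum over the functions whose set of
coordinates different from the base point `z` is exactly `T`. -/
theorem prod_sum_sub_one_eq_sum {ι α : Type*} [Fintype ι] [DecidableEq ι] [Fintype α]
    [DecidableEq α] (z : α) (p : ι → α → ℝ) (hp : ∀ i, p i z = 1) (T : Finset ι) :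
    ∏ i ∈ T, ((∑ a, p i a) - 1)
      = ∑ S : ι → α, if (Finset.univ.filter fun i => S i ≠ z) = T then ∏ i, p i (S i) else 0 := by
  let q : ι → α → ℝ := fun i a => if (a ≠ z ↔ i ∈ T) then p i a else 0
  have hq : ∀ i, ∑ a, q i a = if i ∈ T then (∑ a, p i a) - 1 else 1 := by
    intro i
    by_cases hi : i ∈ T
    · rw [if_pos hi, ← hp i, ← Finset.sum_erase_eq_sub (Finset.mem_univ z)]
      simp only [q, hi, iff_true]
      rw [← Finset.sum_filter, Finset.filter_ne']
    · simp [q, hi, hp]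
  calc ∏ i ∈ T, ((∑ a, p i a) - 1) = ∏ i, ∑ a, q i a := by
        simp only [hq, Finset.prod_ite_mem, Finset.univ_inter]
    _ = ∑ S : ι → α, ∏ i, q i (S i) := Fintype.prod_sum q
    _ = _ := by
        refine Finset.sum_congr rfl fun S _ => ?_
        split_ifs with h
        · refine Finset.prod_congr rfl fun i _ => if_pos ?_
          simp [← h]
        · obtain ⟨i, hi⟩ : ∃ i, ¬(S i ≠ z ↔ i ∈ T) := by
            by_contra! hc
            exact h (Finset.ext fun i => by simpa using hc i)
          exact Finset.prod_eq_zero (Finset.mem_univ i) (if_neg hi)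

theorem innerM_DbarM_chiM {n m : ℕ} (φ : Fin m → (Fin n → Fin 2) → (Fin n → Fin 2) → ℂ)
    (ρ : Matrix (Fin n → Fin 2) (Fin n → Fin 2) ℂ) (S : Fin m → Finset (Fin n)) :
    innerM n m (DbarM n m φ ρ) (chiM S) = ∏ i, innerB n (Dbar n (φ i) ρ) (chiB (S i)) :=
  innerM_prod (fun i => Dbar n (φ i) ρ) (fun i => chiB (S i))

theorem chiM_empty {n m : ℕ} (s : Fin m → Fin n → Fin 2) :
    chiM (fun _ => (∅ : Finset (Fin n))) s = 1 := by
  simp [chiM, chiB]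

/-- The centred mixture of truncations has the Fourier coefficients of the mixture on the
nonzero multi-indices of copy-wise degree `(D, k)`, and no others. -/
theorem sum_truncDk_sub_one {n m D k : ℕ} {J : Type*} [Fintype J] (w : J → ℝ)
    (hw : ∑ j, w j = 1) (F : J → (Fin m → Fin n → Fin 2) → ℝ)
    (hF : ∀ j, innerM n m (F j) (chiM fun _ => ∅) = 1) (s : Fin m → Fin n → Fin 2) :
    (∑ j, w j * truncDk n m D k (F j) s) - 1
      = ∑ S : Fin m → Finset (Fin n),
          (if (∀ i, (S i).card ≤ D) ∧ 0 < (Finset.univ.filter fun i => S i ≠ ∅).card ∧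
              (Finset.univ.filter fun i => S i ≠ ∅).card ≤ k then
            ∑ j, w j * innerM n m (F j) (chiM S) else 0) * chiM S s := by
  have h1 : ∑ j, w j * truncDk n m D k (F j) s
      = ∑ S : Fin m → Finset (Fin n),
          (if (∀ i, (S i).card ≤ D) ∧ (Finset.univ.filter fun i => S i ≠ ∅).card ≤ k then
            ∑ j, w j * innerM n m (F j) (chiM S) else 0) * chiM S s := by
    simp only [truncDk, Finset.mul_sum]
    rw [Finset.sum_comm]
    refine Finset.sum_congr rfl fun S _ => ?_
    split_ifs
    · rw [Finset.sum_mul]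
      exact Finset.sum_congr rfl fun j _ => by ring
    · simp
  have h2 : (1 : ℝ) = ∑ S : Fin m → Finset (Fin n),
      (if S = fun _ => ∅ then 1 else 0) * chiM S s := by
    simp [chiM_empty]
  rw [h1]
  nth_rewrite 1 [h2]
  rw [← Finset.sum_sub_distrib]
  refine Finset.sum_congr rfl fun S _ => ?_
  rw [← sub_mul]
  congr 1
  by_cases hS : S = fun _ => ∅
  · subst hS
    simp [hF, hw]
  · have hpos : 0 < (Finset.univ.filter fun i => S i ≠ ∅).card := by
      rw [Finset.card_pos]
      obtain ⟨i, hi⟩ := Function.ne_iff.mp hS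
      exact ⟨i, by simpa using hi⟩
    simp only [hS, hpos, true_and, if_false, sub_zero]

/-- factorization identity for the copy-wise truncated likelihood ratio. -/
theorem copywise_truncated_LR_factorization
    (n m D k : ℕ) (hn : 1 ≤ n) (hm : 1 ≤ m) (hk : 1 ≤ k)
    (J : Type) [Fintype J] (w : J → ℝ) (hw0 : ∀ j, 0 ≤ w j) (hw1 : ∑ j, w j = 1)
    (ρ : J → Matrix (Fin n → Fin 2) (Fin n → Fin 2) ℂ)
    (hρ : ∀ j, (ρ j).PosSemidef) (htrρ : ∀ j, (ρ j).trace = 1)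
    (φ : Fin m → (Fin n → Fin 2) → (Fin n → Fin 2) → ℂ) (hφ : ∀ i, IsONB (φ i)) :
    innerM n m
        (fun s => (∑ j, w j * truncDk n m D k (DbarM n m φ (ρ j)) s) - 1)
        (fun s => (∑ j, w j * truncDk n m D k (DbarM n m φ (ρ j)) s) - 1)
      = ∑ T : Finset (Fin m),
          if 0 < T.card ∧ T.card ≤ k then
            ∑ j, ∑ j', w j * w j' *
              ∏ i ∈ T,
                (innerB n (truncD n D (Dbar n (φ i) (ρ j)))
                    (truncD n D (Dbar n (φ i) (ρ j'))) - 1)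
          else 0 := by
  set c : J → Fin m → Finset (Fin n) → ℝ := fun j i S => innerB n (Dbar n (φ i) (ρ j)) (chiB S)
    with hc
  have hc1 : ∀ j i, c j i ∅ = 1 := fun j i => innerB_Dbar_chiB_empty (hφ i) (htrρ j)
  have hcM : ∀ j S, innerM n m (DbarM n m φ (ρ j)) (chiM S) = ∏ i, c j i (S i) :=
    fun j S => innerM_DbarM_chiM φ (ρ j) S
  have hprod : ∀ (j j' : J) (T : Finset (Fin m)),
      ∏ i ∈ T, (innerB n (truncD n D (Dbar n (φ i) (ρ j)))
        (truncD n D (Dbar n (φ i) (ρ j'))) - 1)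
      = ∑ S : Fin m → Finset (Fin n), if (Finset.univ.filter fun i => S i ≠ ∅) = T then
          (if ∀ i, (S i).card ≤ D then (∏ i, c j i (S i)) * ∏ i, c j' i (S i) else 0)
        else 0 := by
    intro j j' T
    simp only [innerB_truncD]
    rw [prod_sum_sub_one_eq_sum ∅
      (fun i S => if S.card ≤ D then c j i S * c j' i S else 0) (by simp [hc1])]
    refine Finset.sum_congr rfl fun S _ => ?_
    rw [Finset.prod_ite_zero, Finset.prod_mul_distrib]
    simp
  have hsum : ∀ s, (∑ j, w j * truncDk n m D k (DbarM n m φ (ρ j)) s) - 1 = _ :=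
    sum_truncDk_sub_one w hw1 (fun j => DbarM n m φ (ρ j)) fun j => by simp [hcM, hc1]
  simp only [hsum, innerM_sum_chiM, hprod, hcM]
  have hR : ∀ T : Finset (Fin m),
      (if 0 < T.card ∧ T.card ≤ k then
        ∑ j, ∑ j', w j * w j' *
          ∑ S : Fin m → Finset (Fin n), (if (Finset.univ.filter fun i => S i ≠ ∅) = T then
            (if ∀ i, (S i).card ≤ D then (∏ i, c j i (S i)) * ∏ i, c j' i (S i) else 0)
          else 0) else 0)
      = ∑ S : Fin m → Finset (Fin n), if (Finset.univ.filter fun i => S i ≠ ∅) = T then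
          (if (∀ i, (S i).card ≤ D) ∧ 0 < T.card ∧ T.card ≤ k then
            (∑ j, w j * ∏ i, c j i (S i)) * (∑ j, w j * ∏ i, c j i (S i)) else 0) else 0 := by
    intro T
    by_cases hT : 0 < T.card ∧ T.card ≤ k
    · rw [if_pos hT]
      simp_rw [hT, and_true, Finset.sum_mul_sum, Finset.mul_sum (s := Finset.univ)]
      rw [Finset.sum_congr rfl fun j _ => Finset.sum_comm, Finset.sum_comm]
      refine Finset.sum_congr rfl fun S _ => ?_
      split_ifs
      · exact Finset.sum_congr rfl fun j _ => Finset.sum_congr rfl fun j' _ => by ring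
      all_goals simp
    · simp only [hT, and_false, if_false, ite_self, Finset.sum_const_zero]
  simp only [hR]
  rw [Finset.sum_comm]
  refine Finset.sum_congr rfl fun S _ => ?_
  rw [Finset.sum_ite_eq, if_pos (Finset.mem_univ _)]
  split_ifs <;> simp
end
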